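/- arXiv:1511.08903 — 3 statements merged into one kernel-verified Lean document; each statement's English description precedes it below -/
import Mathlib

section
/- Let φ : ℕ → (0,∞) be monotonically increasing with φ(n) → ∞ as n → ∞, and suppose there exists 0 < α ≤ 1 such that limsup_{n→∞} n/φ(n^{1+α}) = +∞. Then the set E_max^φ = {x ∈ [0,1] : liminf_{n→∞} r_n(x)/φ(n) = 0 and limsup_{n→∞} r_n(x)/φ(n) = +∞} has Hausdorff dimension 1. -/
open Filter MeasureTheory Set

/-- The `k`-th binary digit (for `k ≥ 1`) of a real number `x`,
namely `x_k = ⌊x * 2^k⌋ mod 2`, so that `x = Σ_{k ≥ 1} x_k / 2^k` for `x ∈ [0,1)`. -/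
noncomputable def dyadicDigit (x : ℝ) (k : ℕ) : ℕ :=
  ⌊x * 2 ^ k⌋.toNat % 2

/-- The run-length function: `runLen x n` is the length of the longest run of `1`'s
among the first `n` dyadic digits `x_1, …, x_n` of `x`. -/
noncomputable def runLen (x : ℝ) (n : ℕ) : ℕ :=
  sSup {ℓ : ℕ | ∃ i, i + ℓ ≤ n ∧ ∀ j < ℓ, dyadicDigit x (i + j + 1) = 1}

/-- The exceptional set `E_max^φ` of points of `[0,1]` where `r_n(x)/φ(n)` has
liminf `0` and limsup `+∞`. -/
noncomputable def Emax (φ : ℕ → ℝ) : Set ℝ :=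
  {x ∈ Set.Icc (0 : ℝ) 1 |
    atTop.liminf (fun n => ((runLen x n / φ n : ℝ) : EReal)) = 0 ∧
    atTop.limsup (fun n => ((runLen x n / φ n : ℝ) : EReal)) = ⊤}



theorem od_shift (x : ℕ → Fin 2) :
    Real.ofDigits x = ((x 0 : ℕ) : ℝ) / 2 + Real.ofDigits (fun i => x (i + 1)) / 2 := by
  rw [Real.ofDigits_eq_sum_add_ofDigits x 1]
  simp [Real.ofDigitsTerm]
  ring

theorem fin2_cast (a : Fin 2) : ((a : ℕ) : ℝ) = 0 ∨ ((a : ℕ) : ℝ) = 1 := by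
  fin_cases a <;> simp

theorem od_sub_le (q : ℕ) : ∀ x y : ℕ → Fin 2, x q = y q →
    Real.ofDigits x - Real.ofDigits y ≤ 1 - ((2 : ℝ) ^ (q + 1))⁻¹ := by
  induction q with
  | zero =>
    intro x y h
    rw [od_shift x, od_shift y, h]
    have h1 := Real.ofDigits_le_one (fun i => x (i + 1))
    have h2 := Real.ofDigits_nonneg (fun i => y (i + 1))
    norm_num
    linarith
  | succ q ih =>
    intro x y h
    have := ih (fun i => x (i + 1)) (fun i => y (i + 1)) h
    rw [od_shift x, od_shift y, pow_succ, mul_inv]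
    rcases fin2_cast (x 0) with h1 | h1 <;> rcases fin2_cast (y 0) with h2 | h2 <;>
      rw [h1, h2] <;> linarith

theorem od_sep (n : ℕ) : ∀ (q : ℕ) (x y : ℕ → Fin 2), n < q → (∀ i < n, x i = y i) → x n ≠ y n →
    x q = y q → ((2 : ℝ) ^ (q + 1))⁻¹ ≤ |Real.ofDigits x - Real.ofDigits y| := by
  induction n with
  | zero =>
    intro q x y hq _ hne h
    obtain ⟨q, rfl⟩ : ∃ p, q = p + 1 := ⟨q - 1, by omega⟩
    have h3 := od_sub_le q (fun i => x (i + 1)) (fun i => y (i + 1)) h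
    have h4 := od_sub_le q (fun i => y (i + 1)) (fun i => x (i + 1)) h.symm
    have hne' : ((x 0 : ℕ) : ℝ) ≠ ((y 0 : ℕ) : ℝ) := by
      intro h; exact hne (Fin.ext (by exact_mod_cast h))
    rw [od_shift x, od_shift y, pow_succ, mul_inv, le_abs]
    rcases fin2_cast (x 0) with h1 | h1 <;> rcases fin2_cast (y 0) with h2 | h2 <;>
      rw [h1, h2]
    · exact absurd (h1.trans h2.symm) hne'
    · right; linarith
    · left; linarith
    · exact absurd (h1.trans h2.symm) hne'
  | succ n ih =>
    intro q x y hq hlt hne h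
    obtain ⟨q, rfl⟩ : ∃ p, q = p + 1 := ⟨q - 1, by omega⟩
    have := ih q (fun i => x (i + 1)) (fun i => y (i + 1)) (by omega)
      (fun i hi => hlt (i + 1) (by omega)) hne h
    rw [od_shift x, od_shift y, hlt 0 (by omega), pow_succ, mul_inv]
    rw [show ∀ a b c : ℝ, a / 2 + b / 2 - (a / 2 + c / 2) = (b - c) * 2⁻¹ by intros; ring, abs_mul]
    rw [abs_of_pos (show (0 : ℝ) < 2⁻¹ by norm_num)]
    gcongr

theorem od_lt_one (q : ℕ) (x : ℕ → Fin 2) (h : x q = 0) : Real.ofDigits x < 1 := by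
  have h1 := od_sub_le q x (fun _ => 0) h
  have h2 : Real.ofDigits (fun _ => (0 : Fin 2)) = 0 := by simp [Real.ofDigits, Real.ofDigitsTerm]
  have : (0 : ℝ) < ((2 : ℝ) ^ (q + 1))⁻¹ := by positivity
  linarith

theorem od_expand (x : ℕ → Fin 2) (k : ℕ) : ∃ A : ℕ,
    Real.ofDigits x * 2 ^ (k + 1) =
      ((2 * A + (x k : ℕ) : ℕ) : ℝ) + Real.ofDigits (fun i => x (i + (k + 1))) := by
  induction k with
  | zero => exact ⟨0, by rw [od_shift x]; push_cast; ring⟩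
  | succ k ih =>
    obtain ⟨A, hA⟩ := ih
    refine ⟨2 * A + (x k : ℕ), ?_⟩
    rw [pow_succ, ← mul_assoc, hA, od_shift (fun i => x (i + (k + 1)))]
    simp only [Nat.zero_add, show ∀ i, i + 1 + (k + 1) = i + (k + 1 + 1) by intros; omega]
    push_cast
    ring

theorem digit_od (x : ℕ → Fin 2) (hx : ∀ n, ∃ i ≥ n, x i = 0) (k : ℕ) :
    dyadicDigit (Real.ofDigits x) (k + 1) = (x k : ℕ) := by
  obtain ⟨A, hA⟩ := od_expand x k
  obtain ⟨i, hi, h0⟩ := hx (k + 1)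
  have h1 := od_lt_one (i - (k + 1)) (fun i => x (i + (k + 1))) (by
    simp only [Nat.sub_add_cancel hi, h0])
  have h2 := Real.ofDigits_nonneg (fun i => x (i + (k + 1)))
  have hf : ⌊Real.ofDigits x * 2 ^ (k + 1)⌋ = ((2 * A + (x k : ℕ) : ℕ) : ℤ) := by
    rw [Int.floor_eq_iff, hA, Int.cast_natCast]
    constructor <;> linarith
  unfold dyadicDigit
  rw [hf, Int.toNat_natCast]
  have := (x k).isLt
  omega

theorem dim_param {Ω : Type} [Nonempty Ω] (g h : Ω → ℝ) (C r : NNReal) (hr : 0 < r)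
    (H : ∀ a b, dist (h a) (h b) ≤ C * dist (g a) (g b) ^ (r : ℝ))
    (hs : Set.Icc (0 : ℝ) 1 ⊆ Set.range h) : (r : ENNReal) ≤ dimH (Set.range g) := by
  have key : HolderOnWith C r (h ∘ Function.invFun g) (Set.range g) := by
    rintro _ ⟨a, rfl⟩ _ ⟨b, rfl⟩
    have ha : g (Function.invFun g (g a)) = g a := Function.invFun_eq ⟨a, rfl⟩
    have hb : g (Function.invFun g (g b)) = g b := Function.invFun_eq ⟨b, rfl⟩
    have := H (Function.invFun g (g a)) (Function.invFun g (g b))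
    rw [ha, hb] at this
    rw [edist_dist, edist_dist, ENNReal.ofReal_rpow_of_nonneg dist_nonneg (NNReal.coe_nonneg r),
      ← ENNReal.ofReal_coe_nnreal, ← ENNReal.ofReal_mul (NNReal.coe_nonneg C)]
    exact ENNReal.ofReal_le_ofReal this
  have h1 := key.dimH_image_le hr
  have hsub : Set.Icc (0 : ℝ) 1 ⊆ (h ∘ Function.invFun g) '' Set.range g := by
    intro y hy
    obtain ⟨a, rfl⟩ := hs hy
    refine ⟨g a, ⟨a, rfl⟩, ?_⟩
    have ha : g (Function.invFun g (g a)) = g a := Function.invFun_eq ⟨a, rfl⟩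
    have := H (Function.invFun g (g a)) a
    rw [ha, dist_self, Real.zero_rpow (by exact_mod_cast hr.ne'), mul_zero] at this
    exact dist_le_zero.1 this
  have h2 : dimH (Set.Icc (0 : ℝ) 1) = 1 := by
    rw [Real.dimH_of_nonempty_interior (by simp)]; simp
  have h3 := (dimH_mono hsub).trans h1
  rw [h2, ENNReal.le_div_iff_mul_le (by left; exact_mod_cast hr.ne') (by left; simp), one_mul] at h3
  exact h3

def inBlk (a c : ℕ → ℕ) (i : ℕ) : Prop := ∃ k, c k ≤ i ∧ i < c k + a k

def isFree (m : ℕ) (a c : ℕ → ℕ) (i : ℕ) : Prop := ¬ inBlk a c i ∧ ¬ m ∣ i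

open Classical in
noncomputable def insDig (m : ℕ) (a c : ℕ → ℕ) (d : ℕ → Fin 2) (i : ℕ) : Fin 2 :=
  if inBlk a c i then 1 else if m ∣ i then 0 else d (Nat.count (isFree m a c) i)

theorem card_mult (m n : ℕ) (hm : 0 < m) :
    m * ((Finset.range n).filter (fun i => m ∣ i)).card ≤ n + m := by
  have : (Finset.range n).filter (fun i => m ∣ i) ⊆
      (Finset.range (n / m + 1)).image (fun t => m * t) := by
    intro i hi
    simp only [Finset.mem_filter, Finset.mem_range] at hi
    obtain ⟨h1, t, rfl⟩ := hi
    simp only [Finset.mem_image, Finset.mem_range]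
    refine ⟨t, ?_, rfl⟩
    have : t ≤ n / m := by rw [Nat.le_div_iff_mul_le hm]; linarith
    omega
  have h1 := (Finset.card_le_card this).trans Finset.card_image_le
  rw [Finset.card_range] at h1
  calc _ ≤ m * (n / m + 1) := Nat.mul_le_mul_left _ h1
    _ = m * (n / m) + m := by ring
    _ ≤ n + m := by gcongr; exact Nat.mul_div_le n m

open Classical in
theorem card_blk (m : ℕ) (a c : ℕ → ℕ) (hm : 0 < m) (hk : ∀ k, k ≤ c k)
    (hac : ∀ k, m * 2 ^ (k + 1) * a k ≤ c k) (n : ℕ) :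
    m * ((Finset.range n).filter (fun i => inBlk a c i)).card ≤ n := by
  have hsub : (Finset.range n).filter (fun i => inBlk a c i) ⊆
      (Finset.range n).biUnion (fun k => if c k < n then Finset.Ico (c k) (c k + a k) else ∅) := by
    intro i hi
    simp only [Finset.mem_filter, Finset.mem_range] at hi
    obtain ⟨h1, k, h2, h3⟩ := hi
    simp only [Finset.mem_biUnion, Finset.mem_range]
    refine ⟨k, by have := hk k; omega, ?_⟩
    rw [if_pos (by omega), Finset.mem_Ico]
    exact ⟨h2, h3⟩
  have h1 := (Finset.card_le_card hsub).trans Finset.card_biUnion_le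
  have h2 : ∀ k ∈ Finset.range n,
      (((if c k < n then Finset.Ico (c k) (c k + a k) else ∅ : Finset ℕ).card : ℕ) : ℝ)
        ≤ (n : ℝ) / m * (1 / 2) ^ (k + 1) := by
    intro k _
    split_ifs with h
    · have := hac k
      have h4 : (m : ℝ) * 2 ^ (k + 1) * a k ≤ n := by
        exact_mod_cast this.trans h.le
      rw [Nat.card_Ico, Nat.add_sub_cancel_left, one_div, inv_pow, ← div_eq_mul_inv, div_div,
        le_div_iff₀ (by positivity)]
      linarith
    · simp; positivity
  have h3 : ∀ N : ℕ, ∑ k ∈ Finset.range N, ((1 : ℝ) / 2) ^ (k + 1) = 1 - (1 / 2) ^ N := by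
    intro N
    induction N with
    | zero => simp
    | succ N ih => rw [Finset.sum_range_succ, ih]; ring
  have h4 : (((Finset.range n).filter (fun i => inBlk a c i)).card : ℝ) ≤ (n : ℝ) / m := by
    calc _ ≤ ((∑ k ∈ Finset.range n,
          (if c k < n then Finset.Ico (c k) (c k + a k) else ∅ : Finset ℕ).card : ℕ) : ℝ) := by
          exact_mod_cast h1
      _ ≤ ∑ k ∈ Finset.range n, (n : ℝ) / m * (1 / 2) ^ (k + 1) := by
          rw [Nat.cast_sum]; exact Finset.sum_le_sum h2
      _ = (n : ℝ) / m * (1 - (1 / 2) ^ n) := by rw [← Finset.mul_sum, h3]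
      _ ≤ (n : ℝ) / m * 1 := by
          gcongr
          have : (0 : ℝ) ≤ (1 / 2) ^ n := by positivity
          linarith
      _ = _ := mul_one _
  rw [le_div_iff₀ (by positivity)] at h4
  have : ((Finset.range n).filter (fun i => inBlk a c i)).card * m ≤ n := by exact_mod_cast h4
  linarith

open Classical in
theorem count_free (m : ℕ) (a c : ℕ → ℕ) (hm : 0 < m) (hk : ∀ k, k ≤ c k)
    (hac : ∀ k, m * 2 ^ (k + 1) * a k ≤ c k) (n : ℕ) :
    m * n ≤ m * Nat.count (isFree m a c) n + 2 * n + m := by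
  have h1 := card_mult m n hm
  have h2 := card_blk m a c hm hk hac n
  rw [Nat.count_eq_card_filter_range]
  have h3 : n ≤ ((Finset.range n).filter (fun i => isFree m a c i)).card +
      ((Finset.range n).filter (fun i => m ∣ i)).card +
      ((Finset.range n).filter (fun i => inBlk a c i)).card := by
    have : Finset.range n ⊆ ((Finset.range n).filter (fun i => isFree m a c i)) ∪
      ((Finset.range n).filter (fun i => m ∣ i)) ∪
      ((Finset.range n).filter (fun i => inBlk a c i)) := by
      intro i hi
      simp only [Finset.mem_union, Finset.mem_filter, hi, true_and]
      unfold isFree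
      tauto
    have h := Finset.card_le_card this
    rw [Finset.card_range] at h
    refine h.trans ((Finset.card_union_le _ _).trans ?_)
    gcongr
    exact Finset.card_union_le _ _
  have := Nat.mul_le_mul_left m h3
  linarith

open Classical in
theorem free_inf (m : ℕ) (a c : ℕ → ℕ) (hm : 3 ≤ m) (hk : ∀ k, k ≤ c k)
    (hac : ∀ k, m * 2 ^ (k + 1) * a k ≤ c k) : (Set.ofPred (isFree m a c)).Infinite := by
  intro hf
  have hb : ∀ n, Nat.count (isFree m a c) n ≤ hf.toFinset.card := by
    intro n
    rw [Nat.count_eq_card_filter_range]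
    apply Finset.card_le_card
    intro i hi
    rw [Set.Finite.mem_toFinset]
    exact (Finset.mem_filter.1 hi).2
  set K := hf.toFinset.card
  have h1 := count_free m a c (by omega) hk hac (m * K + m + 1)
  have h2 := Nat.mul_le_mul_left m (hb (m * K + m + 1))
  have h3 := Nat.mul_le_mul_right (m * K + m + 1) hm
  linarith

theorem ins_dim (m : ℕ) (a c : ℕ → ℕ) (hm : 3 ≤ m) (hk : ∀ k, k ≤ c k)
    (hac : ∀ k, m * 2 ^ (k + 1) * a k ≤ c k) :
    ENNReal.ofReal (1 - 2 / m) ≤ dimH (Set.range (fun d => Real.ofDigits (insDig m a c d))) := by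
  classical
  have hm0 : (0 : ℝ) < m := by positivity
  have hs : (0 : ℝ) < 1 - 2 / m := by
    rw [sub_pos, div_lt_one hm0]; exact_mod_cast (by omega : 2 < m)
  have hs1 : (1 : ℝ) - 2 / m ≤ 1 := by
    have : (0 : ℝ) ≤ 2 / m := by positivity
    linarith
  refine dim_param (fun d => Real.ofDigits (insDig m a c d)) (fun d => Real.ofDigits d)
    ((2 : NNReal) ^ (m + 2)) (Real.toNNReal (1 - 2 / m)) (Real.toNNReal_pos.2 hs) ?_ ?_
  · intro x y
    rw [Real.coe_toNNReal _ hs.le]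
    by_cases hxy : x = y
    · subst hxy; simp; positivity
    have hex : ∃ j, x j ≠ y j := by
      by_contra! h; exact hxy (funext h)
    let j := Nat.find hex
    have hj : x j ≠ y j := Nat.find_spec hex
    have hjl : ∀ i < j, x i = y i := fun i hi => not_not.1 (Nat.find_min hex hi)
    have hinf := free_inf m a c hm hk hac
    obtain ⟨n, hn⟩ : ∃ n, n = Nat.nth (isFree m a c) j := ⟨_, rfl⟩
    have hnf : isFree m a c n := hn ▸ Nat.nth_mem_of_infinite hinf j
    have hnc : Nat.count (isFree m a c) n = j := by
      rw [hn]; exact Nat.count_nth_of_infinite hinf j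
    have hq : m ∣ m * (n / m + 1) := ⟨_, rfl⟩
    have hq1 : n < m * (n / m + 1) := Nat.lt_mul_div_succ n (by omega)
    have hq2 : m * (n / m + 1) ≤ n + m := by
      have := Nat.mul_div_le n m
      linarith
    set q := m * (n / m + 1)
    have h1 := od_sep n q (insDig m a c x) (insDig m a c y) hq1
      (by
        intro i hi
        unfold insDig
        split_ifs with h1 h2
        · rfl
        · rfl
        · apply hjl
          rw [← hnc]
          exact Nat.count_strict_mono ⟨h1, h2⟩ hi)
      (by
        unfold insDig
        rw [if_neg hnf.1, if_neg hnf.2, if_neg hnf.1, if_neg hnf.2, hnc]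
        exact hj)
      (by
        unfold insDig
        rw [if_pos hq, if_pos hq])
    have h2 := Real.abs_ofDigits_sub_ofDigits_le hjl
    rw [Real.dist_eq, Real.dist_eq]
    refine h2.trans ?_
    have h3 : (((2 : ℝ) ^ (q + 1))⁻¹) ^ (1 - 2 / m : ℝ) ≤
      |Real.ofDigits (insDig m a c x) - Real.ofDigits (insDig m a c y)| ^ (1 - 2 / m : ℝ) :=
      Real.rpow_le_rpow (by positivity) h1 hs.le
    refine le_trans ?_ (mul_le_mul_of_nonneg_left h3 (by positivity))
    have hcf := count_free m a c (by omega) hk hac n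
    rw [hnc] at hcf
    have hcf' : (m : ℝ) * n ≤ m * j + 2 * n + m := by exact_mod_cast hcf
    have h4 : (1 - 2 / m : ℝ) * n ≤ j + 1 := by
      have : (1 - 2 / m : ℝ) * n = (m * n - 2 * n) / m := by field_simp
      rw [this, div_le_iff₀ hm0]; linarith
    have h5 : (1 - 2 / m : ℝ) * (q + 1) ≤ j + (m + 2) := by
      have h6 : ((q : ℝ) + 1) ≤ n + (m + 1) := by
        have : (q : ℝ) ≤ n + m := by exact_mod_cast hq2
        linarith
      calc _ ≤ (1 - 2 / m : ℝ) * (n + (m + 1)) := by gcongr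
        _ = (1 - 2 / m : ℝ) * n + (1 - 2 / m : ℝ) * (m + 1) := by ring
        _ ≤ (j + 1) + 1 * (m + 1) := by gcongr
        _ = _ := by ring
    push_cast
    rw [← Real.rpow_natCast 2 j, ← Real.rpow_natCast 2 (q + 1), ← Real.rpow_natCast 2 (m + 2),
      ← Real.rpow_neg (by norm_num), ← Real.rpow_neg (by norm_num),
      ← Real.rpow_mul (by norm_num), ← Real.rpow_add (by norm_num)]
    apply Real.rpow_le_rpow_of_exponent_le (by norm_num)
    push_cast
    nlinarith
  · intro y hy
    obtain ⟨d, _, hd⟩ := Real.ofDigits_SurjOn (b := 2) (by norm_num) hy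
    exact ⟨d, hd⟩

theorem ins_mem (φ : ℕ → ℝ) (hpos : ∀ n, 0 < φ n) (m : ℕ) (a c B : ℕ → ℕ) (hm : 0 < m)
    (hk : ∀ k, k ≤ c k) (hB : ∀ k, B (k + 1) = c k + a k) (hBc : ∀ k, B k ≤ c k)
    (hBm : ∀ k, B k + m ≤ c k)
    (h1 : ∀ k : ℕ, ((k : ℝ) + 1) * φ (c k + a k) ≤ a k)
    (h2 : ∀ k : ℕ, ((k : ℝ) + 1) * ((B k : ℝ) + m) ≤ φ (c k)) (d : ℕ → Fin 2) :
    Real.ofDigits (insDig m a c d) ∈ Emax φ := by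
  classical
  have hBmono : Monotone B := monotone_nat_of_le_succ (fun k => by
    rw [hB]; exact (hBc k).trans (Nat.le_add_right _ _))
  -- gaps contain no block positions
  have hgap : ∀ k i, B k ≤ i → i < c k → ¬ inBlk a c i := by
    rintro k i hi1 hi2 ⟨l, hl1, hl2⟩
    rcases lt_or_ge l k with h | h
    · have := hBmono (show l + 1 ≤ k by omega)
      rw [hB] at this
      omega
    · rcases h.eq_or_lt with h | h
      · subst h; omega
      · have := hBmono (show k + 1 ≤ l by omega)
        rw [hB] at this
        have := hBc l
        omega
  have hzero : ∀ k i, B k ≤ i → i < c k → m ∣ i → insDig m a c d i = 0 := by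
    intro k i h1 h2 h3
    unfold insDig
    rw [if_neg (hgap k i h1 h2), if_pos h3]
  have hmul : ∀ n, ∃ q, n ≤ q ∧ q < n + m ∧ m ∣ q := by
    intro n
    refine ⟨m * ((n + m - 1) / m), ?_, ?_, ⟨_, rfl⟩⟩
    · have := Nat.lt_mul_div_succ (n + m - 1) hm
      rw [mul_add] at this
      omega
    · have := Nat.mul_div_le (n + m - 1) m
      omega
  have hcB : ∀ k, k ≤ B (k + 1) := fun k => by rw [hB]; exact (hk k).trans (Nat.le_add_right _ _)
  have hinf : ∀ n, ∃ i ≥ n, insDig m a c d i = 0 := by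
    intro n
    obtain ⟨q, hq1, hq2, hq3⟩ := hmul (B (n + 1))
    have := hBm (n + 1)
    have := hcB n
    exact ⟨q, by omega, hzero (n + 1) q hq1 (by omega) hq3⟩
  have hdig := digit_od _ hinf
  set x := Real.ofDigits (insDig m a c d) with hx
  have hupper : ∀ k, runLen x (c k) ≤ B k + m := by
    intro k
    unfold runLen
    refine csSup_le ⟨0, 0, by simp⟩ ?_
    rintro l ⟨i, hil, hi⟩
    by_contra! hl
    obtain ⟨q, hq1, hq2, hq3⟩ := hmul (i + B k)
    have h0 := hzero k q (by omega) (by omega) hq3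
    have h := hi (q - i) (by omega)
    rw [show i + (q - i) + 1 = q + 1 by omega, hdig, h0] at h
    simp at h
  have hlower : ∀ k, a k ≤ runLen x (c k + a k) := by
    intro k
    unfold runLen
    refine le_csSup ⟨c k + a k, ?_⟩ ⟨c k, le_rfl, ?_⟩
    · rintro l ⟨i, hil, _⟩; omega
    · intro j hj
      rw [hdig]
      unfold insDig
      rw [if_pos ⟨k, by omega, by omega⟩]
      rfl
  refine ⟨⟨Real.ofDigits_nonneg _, Real.ofDigits_le_one _⟩, ?_, ?_⟩
  · apply le_antisymm
    · apply le_of_forall_gt_imp_ge_of_dense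
      intro e he
      obtain ⟨r, hr0, hre⟩ := EReal.lt_iff_exists_real_btwn.1 he
      have hr0' : (0 : ℝ) < r := by exact_mod_cast hr0
      refine le_trans ?_ hre.le
      apply liminf_le_of_frequently_le'
      rw [frequently_atTop]
      intro N
      obtain ⟨K, hK⟩ := exists_nat_one_div_lt hr0'
      have hkk : ((K : ℝ) + 1) ≤ ((max N K : ℕ) : ℝ) + 1 := by
        gcongr; exact le_max_right _ _
      refine ⟨c (max N K), (le_max_left _ _).trans (hk _), ?_⟩
      rw [EReal.coe_le_coe_iff, div_le_iff₀ (hpos _)]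
      have hu : (runLen x (c (max N K)) : ℝ) ≤ B (max N K) + m := by exact_mod_cast hupper _
      have h3 := h2 (max N K)
      rw [one_div, inv_lt_iff_one_lt_mul₀ (by positivity)] at hK
      have h4 : 1 ≤ r * (((max N K : ℕ) : ℝ) + 1) := by
        refine hK.le.trans ?_
        gcongr
      calc (runLen x (c (max N K)) : ℝ) ≤ 1 * (B (max N K) + m) := by linarith
        _ ≤ (r * (((max N K : ℕ) : ℝ) + 1)) * (B (max N K) + m) := by gcongr
        _ = r * ((((max N K : ℕ) : ℝ) + 1) * (B (max N K) + m)) := by ring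
        _ ≤ _ := by gcongr
    · refine le_liminf_of_le (by isBoundedDefault) (Eventually.of_forall fun n => ?_)
      have : (0 : ℝ) ≤ runLen x n / φ n := div_nonneg (Nat.cast_nonneg _) (hpos n).le
      exact_mod_cast this
  · rw [EReal.eq_top_iff_forall_lt]
    intro r
    obtain ⟨K, hK⟩ := exists_nat_gt r
    refine lt_of_lt_of_le (EReal.coe_lt_coe_iff.2 hK) ?_
    apply le_limsup_of_frequently_le'
    rw [frequently_atTop]
    intro N
    refine ⟨c (max N K) + a (max N K),
      ((le_max_left _ _).trans (hk _)).trans (Nat.le_add_right _ _), ?_⟩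
    rw [EReal.coe_le_coe_iff, le_div_iff₀ (hpos _)]
    have hl : (a (max N K) : ℝ) ≤ runLen x (c (max N K) + a (max N K)) := by
      exact_mod_cast hlower _
    refine le_trans ?_ ((h1 (max N K)).trans hl)
    have : (K : ℝ) ≤ ((max N K : ℕ) : ℝ) := by exact_mod_cast le_max_right _ _
    have hp := hpos (c (max N K) + a (max N K))
    gcongr
    linarith

theorem exists_step (φ : ℕ → ℝ) (hpos : ∀ n, 0 < φ n)
    (htends : Tendsto φ atTop atTop)
    (hA : ∃ α : ℝ, 0 < α ∧ α ≤ 1 ∧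
      atTop.limsup (fun n : ℕ => (((n : ℝ) / φ ⌊(n : ℝ) ^ (1 + α)⌋₊ : ℝ) : EReal)) = ⊤)
    (m k B : ℕ) : ∃ a c : ℕ, k ≤ c ∧ B + m ≤ c ∧ m * 2 ^ (k + 1) * a ≤ c ∧
      ((k : ℝ) + 1) * φ (c + a) ≤ a ∧ ((k : ℝ) + 1) * ((B : ℝ) + m) ≤ φ c := by
  obtain ⟨α, hα, _, hlim⟩ := hA
  have hfr : ∃ᶠ n : ℕ in atTop, (((k : ℝ) + 1 : ℝ) : EReal) <
      (((n : ℝ) / φ ⌊(n : ℝ) ^ (1 + α)⌋₊ : ℝ) : EReal) :=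
    frequently_lt_of_lt_limsup (by isBoundedDefault) (by rw [hlim]; exact EReal.coe_lt_top _)
  obtain ⟨M, hM⟩ := eventually_atTop.1 (htends.eventually_ge_atTop (((k : ℝ) + 1) * ((B : ℝ) + m)))
  have hpw : Tendsto (fun n : ℕ => (n : ℝ) ^ α) atTop atTop :=
    (tendsto_rpow_atTop hα).comp tendsto_natCast_atTop_atTop
  have hev := (hpw.eventually_ge_atTop ((m * 2 ^ (k + 1) + 2 : ℕ) : ℝ)).and
    (eventually_ge_atTop (k + B + m + M + 1))
  obtain ⟨n, hn1, hn2, hn3⟩ := (hfr.and_eventually hev).exists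
  rw [EReal.coe_lt_coe_iff, lt_div_iff₀ (hpos _)] at hn1
  have hfl : (m * 2 ^ (k + 1) + 2) * n ≤ ⌊(n : ℝ) ^ (1 + α)⌋₊ := by
    apply Nat.le_floor
    have hn0 : (0 : ℝ) < n := by exact_mod_cast (by omega : 0 < n)
    rw [Real.rpow_add hn0, Real.rpow_one, mul_comm, Nat.cast_mul]
    gcongr
  set b := ⌊(n : ℝ) ^ (1 + α)⌋₊
  have hb : m * 2 ^ (k + 1) * n + n + n ≤ b := by linarith
  generalize hP : m * 2 ^ (k + 1) * n = P at hb
  refine ⟨n, b - n, by omega, by omega, by omega, ?_, hM _ (by omega)⟩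
  rw [Nat.sub_add_cancel (by omega)]
  exact hn1.le

theorem dimH_Emax_eq_one_of_power (φ : ℕ → ℝ) (hpos : ∀ n, 0 < φ n) (hmono : Monotone φ)
    (htends : Tendsto φ atTop atTop)
    (hA : ∃ α : ℝ, 0 < α ∧ α ≤ 1 ∧
      atTop.limsup (fun n : ℕ => (((n : ℝ) / φ ⌊(n : ℝ) ^ (1 + α)⌋₊ : ℝ) : EReal)) = ⊤) :
    dimH (Emax φ) = 1 := by
  apply le_antisymm
  · exact (dimH_mono (Set.subset_univ _)).trans Real.dimH_univ.le
  have key : ∀ m : ℕ, 3 ≤ m → ENNReal.ofReal (1 - 2 / m) ≤ dimH (Emax φ) := by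
    intro m hm
    choose a c h1 h2 h3 h4 h5 using exists_step φ hpos htends hA m
    let B : ℕ → ℕ := fun k => Nat.rec 0 (fun k b => c k b + a k b) k
    refine (ins_dim m (fun k => a k (B k)) (fun k => c k (B k)) hm (fun k => h1 _ _)
      (fun k => h3 _ _)).trans (dimH_mono ?_)
    rintro _ ⟨d, rfl⟩
    exact ins_mem φ hpos m _ _ B (by omega) (fun k => h1 _ _) (fun k => rfl)
      (fun k => (Nat.le_add_right _ _).trans (h2 k (B k))) (fun k => h2 _ _)
      (fun k => h4 _ _) (fun k => h5 _ _) d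
  have ht : Tendsto (fun m : ℕ => ENNReal.ofReal (1 - 2 / (m : ℝ))) atTop (nhds 1) := by
    have : Tendsto (fun m : ℕ => (1 : ℝ) - 2 / (m : ℝ)) atTop (nhds (1 - 0)) :=
      tendsto_const_nhds.sub (tendsto_const_div_atTop_nhds_zero_nat 2)
    simpa using ENNReal.tendsto_ofReal this
  exact le_of_tendsto ht (eventually_atTop.2 ⟨3, key⟩)
end

section
/- (Erdős–Rényi) For Lebesgue-almost every x ∈ [0,1], lim_{n→∞} r_n(x)/log₂ n = 1. -/
open Filter MeasureTheory Set

lemma erl_bdd (x : ℝ) (n : ℕ) :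
    BddAbove {ℓ : ℕ | ∃ i, i + ℓ ≤ n ∧ ∀ j < ℓ, dyadicDigit x (i + j + 1) = 1} :=
  ⟨n, by rintro ℓ ⟨i, hi, -⟩; omega⟩

lemma erl_le_iff (x : ℝ) (n ℓ : ℕ) :
    ℓ ≤ runLen x n ↔ ∃ i, i + ℓ ≤ n ∧ ∀ j < ℓ, dyadicDigit x (i + j + 1) = 1 := by
  constructor
  · intro h
    have := Nat.sSup_mem (s := {ℓ : ℕ | ∃ i, i + ℓ ≤ n ∧ ∀ j < ℓ, dyadicDigit x (i + j + 1) = 1})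
      ⟨0, 0, by simp⟩ (erl_bdd x n)
    obtain ⟨i, hi, hj⟩ := this
    change i + runLen x n ≤ n at hi
    change ∀ j < runLen x n, _ at hj
    exact ⟨i, by omega, fun j hjl => hj j (by omega)⟩
  · intro h
    exact le_csSup (erl_bdd x n) h

lemma erl_mono (x : ℝ) {n m : ℕ} (h : n ≤ m) : runLen x n ≤ runLen x m := by
  obtain ⟨i, hi, hj⟩ := (erl_le_iff x n _).1 le_rfl
  exact (erl_le_iff x m _).2 ⟨i, by omega, hj⟩

lemma erl_shift (x : ℝ) (hx : 0 ≤ x) (i k : ℕ) :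
    dyadicDigit x (i + (k + 1)) = dyadicDigit (Int.fract (x * 2 ^ i)) (k + 1) := by
  unfold dyadicDigit
  have h : x * 2 ^ (i + (k + 1)) =
      Int.fract (x * 2 ^ i) * 2 ^ (k + 1) + ((⌊x * 2 ^ i⌋ * 2 ^ (k + 1) : ℤ) : ℝ) := by
    push_cast
    rw [Int.fract]; ring
  rw [h, Int.floor_add_intCast]
  have h1 : 0 ≤ ⌊x * 2 ^ i⌋ := Int.floor_nonneg.2 (by positivity)
  have h2 : 0 ≤ ⌊Int.fract (x * 2 ^ i) * 2 ^ (k + 1)⌋ :=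
    Int.floor_nonneg.2 (mul_nonneg (Int.fract_nonneg _) (by positivity))
  have h3 : (⌊x * 2 ^ i⌋ * 2 ^ (k + 1) : ℤ) = 2 * (⌊x * 2 ^ i⌋ * 2 ^ k) := by ring
  have h4 : 0 ≤ ⌊x * 2 ^ i⌋ * 2 ^ k := by positivity
  rw [h3]
  omega

lemma erl_ones_of (x : ℝ) (h0 : 0 ≤ x) (ℓ : ℕ)
    (h : ∀ j < ℓ, dyadicDigit x (j + 1) = 1) : 2 ^ ℓ - 1 ≤ ⌊x * 2 ^ ℓ⌋ := by
  induction ℓ with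
  | zero => simpa using Int.floor_nonneg.2 h0
  | succ ℓ ih =>
    have ih := ih (fun j hj => h j (by omega))
    have h1 := h ℓ (by omega)
    unfold dyadicDigit at h1
    have h2 : 2 * ⌊x * 2 ^ ℓ⌋ ≤ ⌊x * 2 ^ (ℓ + 1)⌋ := by
      rw [Int.le_floor]
      push_cast
      have := Int.floor_le (x * 2 ^ ℓ)
      rw [pow_succ]; linarith
    have h5 : (2 : ℤ) ^ (ℓ + 1) = 2 * 2 ^ ℓ := by ring
    rw [h5]
    omega

lemma erl_of_ones (x : ℝ) (hx1 : x < 1) (ℓ : ℕ)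
    (h : 2 ^ ℓ - 1 ≤ ⌊x * 2 ^ ℓ⌋) : ∀ j < ℓ, dyadicDigit x (j + 1) = 1 := by
  intro j hj
  have hx : (2 : ℝ) ^ ℓ - 1 ≤ x * 2 ^ ℓ := by
    rw [Int.le_floor] at h; exact_mod_cast h
  have hfl : ⌊x * 2 ^ (j + 1)⌋ = 2 ^ (j + 1) - 1 := by
    rw [Int.floor_eq_iff]
    push_cast
    have hp : (0 : ℝ) < 2 ^ (j + 1) := by positivity
    constructor
    · obtain ⟨d, rfl⟩ := Nat.exists_eq_add_of_le (Nat.succ_le_of_lt hj)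
      rw [Nat.succ_eq_add_one, pow_add] at hx
      have hd : (1 : ℝ) ≤ 2 ^ d := one_le_pow₀ (by norm_num)
      by_contra hc
      push Not at hc
      nlinarith
    · nlinarith
  unfold dyadicDigit
  rw [hfl]
  have h5 : (2 : ℤ) ^ (j + 1) = 2 * 2 ^ j := by ring
  have : (0 : ℤ) < 2 ^ j := by positivity
  rw [h5]
  omega

lemma erl_meas (b : ℕ) (hb : 0 < b) (D : Finset ℕ) (E : Set ℝ) :
    volume {x : ℝ | x ∈ Ico (0 : ℝ) 1 ∧ ⌊x * b⌋.toNat ∈ D ∧ Int.fract (x * b) ∈ E} ≤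
      ENNReal.ofReal (D.card / b) * volume E := by
  have hb' : (0 : ℝ) < b := by exact_mod_cast hb
  have hsub : {x : ℝ | x ∈ Ico (0 : ℝ) 1 ∧ ⌊x * b⌋.toNat ∈ D ∧ Int.fract (x * b) ∈ E} ⊆
      ⋃ d ∈ D, (fun x : ℝ => x * b) ⁻¹' ((fun x : ℝ => x - (d : ℝ)) ⁻¹' E) := by
    rintro x ⟨hx, hd, hE⟩
    simp only [mem_iUnion]
    refine ⟨_, hd, ?_⟩
    have h1 : 0 ≤ ⌊x * b⌋ := Int.floor_nonneg.2 (mul_nonneg hx.1 hb'.le)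
    have h2 : ((⌊x * b⌋.toNat : ℕ) : ℝ) = (⌊x * b⌋ : ℝ) := by
      exact_mod_cast congrArg (Int.cast (R := ℝ)) (Int.toNat_of_nonneg h1)
    simp only [mem_preimage, h2]
    exact hE
  refine (measure_mono hsub).trans ((measure_biUnion_finset_le _ _).trans ?_)
  simp_rw [Real.volume_preimage_mul_right hb'.ne', sub_eq_add_neg, measure_preimage_add_right]
  rw [Finset.sum_const, nsmul_eq_mul, ← mul_assoc, abs_of_pos (inv_pos.2 hb'), div_eq_mul_inv,
    ENNReal.ofReal_mul (by positivity), ENNReal.ofReal_natCast]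

lemma erl_upper (i ℓ : ℕ) :
    volume {x : ℝ | x ∈ Ico (0 : ℝ) 1 ∧ ∀ j < ℓ, dyadicDigit x (i + j + 1) = 1} ≤
      ENNReal.ofReal ((2 ^ ℓ)⁻¹) := by
  have hp : (0 : ℝ) < 2 ^ ℓ := by positivity
  have hpi : (0 : ℝ) < 2 ^ i := by positivity
  calc _ ≤ volume {x : ℝ | x ∈ Ico (0 : ℝ) 1 ∧ ⌊x * (2 ^ i : ℕ)⌋.toNat ∈ Finset.range (2 ^ i) ∧
          Int.fract (x * (2 ^ i : ℕ)) ∈ Ico (1 - (2 ^ ℓ)⁻¹ : ℝ) 1} := by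
        apply measure_mono
        rintro x ⟨hx, hj⟩
        refine ⟨hx, ?_, ?_, Int.fract_lt_one _⟩
        · rw [Finset.mem_range]
          have h1 : ⌊x * (2 ^ i : ℕ)⌋ < (2 ^ i : ℕ) := by
            rw [Int.floor_lt]
            push_cast
            nlinarith [hx.2]
          have h0 : 0 ≤ ⌊x * (2 ^ i : ℕ)⌋ := Int.floor_nonneg.2 (mul_nonneg hx.1 (by positivity))
          omega
        · push_cast
          have := erl_ones_of (Int.fract (x * 2 ^ i)) (Int.fract_nonneg _) ℓ
            (fun j hjl => by rw [← erl_shift x hx.1]; exact hj j hjl)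
          rw [Int.le_floor] at this
          push_cast at this
          rw [sub_le_iff_le_add]
          have h3 : (2 ^ ℓ : ℝ) * (2 ^ ℓ)⁻¹ = 1 := mul_inv_cancel₀ hp.ne'
          by_contra hc
          push Not at hc
          nlinarith
    _ ≤ _ := erl_meas _ (by positivity) _ _
    _ ≤ _ := by
        rw [Finset.card_range, Real.volume_Ico, div_self (by positivity)]
        simp

lemma erl_lower (ℓ K : ℕ) :
    volume {x : ℝ | x ∈ Ico (0 : ℝ) 1 ∧ ∀ k < K, ¬ ∀ j < ℓ, dyadicDigit x (k * ℓ + j + 1) = 1} ≤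
      ENNReal.ofReal (Real.exp (- (K * (2 ^ ℓ)⁻¹))) := by
  induction K with
  | zero =>
    refine (measure_mono (t := Ico (0 : ℝ) 1) fun x hx => hx.1).trans ?_
    simp
  | succ K ih =>
    have hp : (0 : ℝ) < 2 ^ ℓ := by positivity
    calc _ ≤ volume {x : ℝ | x ∈ Ico (0 : ℝ) 1 ∧
            ⌊x * (2 ^ ℓ : ℕ)⌋.toNat ∈ Finset.range (2 ^ ℓ - 1) ∧
            Int.fract (x * (2 ^ ℓ : ℕ)) ∈ {x : ℝ | x ∈ Ico (0 : ℝ) 1 ∧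
              ∀ k < K, ¬ ∀ j < ℓ, dyadicDigit x (k * ℓ + j + 1) = 1}} := by
          apply measure_mono
          rintro x ⟨hx, hk⟩
          refine ⟨hx, ?_, ⟨Int.fract_nonneg _, Int.fract_lt_one _⟩, ?_⟩
          · rw [Finset.mem_range]
            by_contra hc
            apply hk 0 (by omega)
            intro j hj
            have := erl_of_ones x hx.2 ℓ ?_ j hj
            · simpa using this
            · push_cast at hc
              have h0 : 0 ≤ ⌊x * 2 ^ ℓ⌋ := Int.floor_nonneg.2 (mul_nonneg hx.1 (by positivity))
              have h1 : (((2 ^ ℓ : ℕ)) : ℤ) = 2 ^ ℓ := by push_cast; rfl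
              omega
          · intro k hkK hall
            apply hk (k + 1) (by omega)
            intro j hj
            have := hall j hj
            push_cast at this
            rw [← erl_shift x hx.1] at this
            have e : (k + 1) * ℓ + j + 1 = ℓ + (k * ℓ + j + 1) := by ring
            rw [e]
            exact this
      _ ≤ _ := erl_meas _ (by positivity) _ _
      _ ≤ _ := mul_le_mul_right ih _
      _ ≤ _ := by
          rw [← ENNReal.ofReal_mul (by positivity)]
          apply ENNReal.ofReal_le_ofReal
          rw [Finset.card_range, Nat.cast_sub Nat.one_le_two_pow]
          push_cast
          have h1 : ((2 : ℝ) ^ ℓ - 1) / 2 ^ ℓ ≤ Real.exp (-(2 ^ ℓ)⁻¹) := by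
            have := Real.add_one_le_exp (-((2 : ℝ) ^ ℓ)⁻¹)
            rw [sub_div, div_self hp.ne', one_div]
            linarith
          calc _ ≤ Real.exp (-(2 ^ ℓ)⁻¹) * Real.exp (-(K * (2 ^ ℓ)⁻¹)) := by gcongr
            _ = _ := by rw [← Real.exp_add]; ring_nf

lemma erl_le_pow (m : ℕ) : (m : ℝ) ≤ 2 ^ (Nat.log 2 m + 1) := by
  exact_mod_cast (Nat.lt_pow_succ_log_self (by norm_num) m).le

lemma erl_ae_upper : ∀ᵐ x ∂(volume.restrict (Ico (0 : ℝ) 1)),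
    ∀ᶠ m : ℕ in atTop, runLen x (2 ^ m) < m + 2 * (Nat.log 2 m + 1) := by
  have key : ∀ m : ℕ, 1 ≤ m → (volume.restrict (Ico (0 : ℝ) 1))
      {x | m + 2 * (Nat.log 2 m + 1) ≤ runLen x (2 ^ m)} ≤ ENNReal.ofReal (1 / (m : ℝ) ^ 2) := by
    intro m hm
    rw [Measure.restrict_apply' measurableSet_Ico]
    have hm' : (0 : ℝ) < m := by exact_mod_cast hm
    set ℓ := m + 2 * (Nat.log 2 m + 1) with hℓ
    have hsub : {x | ℓ ≤ runLen x (2 ^ m)} ∩ Ico (0 : ℝ) 1 ⊆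
        ⋃ i ∈ Finset.range (2 ^ m),
          {x : ℝ | x ∈ Ico (0 : ℝ) 1 ∧ ∀ j < ℓ, dyadicDigit x (i + j + 1) = 1} := by
      rintro x ⟨h, hx⟩
      obtain ⟨i, hi, hj⟩ := (erl_le_iff _ _ _).1 h
      simp only [mem_iUnion]
      exact ⟨i, Finset.mem_range.2 (by omega), hx, hj⟩
    refine (measure_mono hsub).trans ((measure_biUnion_finset_le _ _).trans ?_)
    refine (Finset.sum_le_sum (fun i _ => erl_upper i ℓ)).trans ?_
    rw [Finset.sum_const, nsmul_eq_mul, ← ENNReal.ofReal_natCast,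
      ← ENNReal.ofReal_mul (by positivity)]
    apply ENNReal.ofReal_le_ofReal
    rw [Finset.card_range, hℓ]
    push_cast
    rw [pow_add, mul_inv, ← mul_assoc, mul_inv_cancel₀ (by positivity), one_mul, one_div,
      mul_comm 2, pow_mul]
    have := erl_le_pow m
    gcongr
  have hsum : ∑' m : ℕ, (volume.restrict (Ico (0 : ℝ) 1))
      {x | m + 1 + 2 * (Nat.log 2 (m + 1) + 1) ≤ runLen x (2 ^ (m + 1))} ≠ ⊤ := by
    refine ne_top_of_le_ne_top ?_ (ENNReal.tsum_le_tsum (fun m => key (m + 1) (by omega)))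
    apply Summable.tsum_ofReal_ne_top
    exact (summable_nat_add_iff 1).2 (Real.summable_one_div_nat_pow.2 (by norm_num))
  filter_upwards [ae_eventually_notMem hsum] with x hx
  obtain ⟨M, hM⟩ := eventually_atTop.1 hx
  refine eventually_atTop.2 ⟨M + 1, fun m hm => ?_⟩
  obtain ⟨k, rfl⟩ : ∃ k, m = k + 1 := ⟨m - 1, by omega⟩
  have := hM k (by omega)
  simpa using this

lemma erl_ae_lower : ∀ᵐ x ∂(volume.restrict (Ico (0 : ℝ) 1)),
    ∀ᶠ m : ℕ in atTop, m - 2 * (Nat.log 2 m + 1) ≤ runLen x (2 ^ m) := by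
  have key : ∀ m : ℕ, (volume.restrict (Ico (0 : ℝ) 1))
      {x | ¬ m - 2 * (Nat.log 2 m + 1) ≤ runLen x (2 ^ m)} ≤ ENNReal.ofReal (Real.exp (-m)) := by
    intro m
    by_cases hms : m < 2 * (Nat.log 2 m + 1)
    · have : m - 2 * (Nat.log 2 m + 1) = 0 := by omega
      simp [this]
    push Not at hms
    rw [Measure.restrict_apply' measurableSet_Ico]
    set s := Nat.log 2 m + 1 with hs
    set ℓ := m - 2 * s with hℓ
    have hmp : m ≤ 2 ^ s := (Nat.lt_pow_succ_log_self (by norm_num) m).le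
    have hK : 2 ^ (m - s) * 2 ^ s = 2 ^ m := by rw [← pow_add]; congr 1; omega
    have hK' : 2 ^ (m - s) = 2 ^ s * 2 ^ ℓ := by rw [← pow_add]; congr 1; omega
    have hsub : {x | ¬ ℓ ≤ runLen x (2 ^ m)} ∩ Ico (0 : ℝ) 1 ⊆
        {x : ℝ | x ∈ Ico (0 : ℝ) 1 ∧
          ∀ k < 2 ^ (m - s), ¬ ∀ j < ℓ, dyadicDigit x (k * ℓ + j + 1) = 1} := by
      rintro x ⟨h, hx⟩
      refine ⟨hx, fun k hk hall => h ((erl_le_iff _ _ _).2 ⟨k * ℓ, ?_, hall⟩)⟩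
      calc k * ℓ + ℓ = (k + 1) * ℓ := by ring
        _ ≤ 2 ^ (m - s) * 2 ^ s := Nat.mul_le_mul hk (by omega)
        _ = _ := hK
    refine (measure_mono hsub).trans ((erl_lower _ _).trans ?_)
    apply ENNReal.ofReal_le_ofReal
    apply Real.exp_le_exp.2
    rw [hK']
    push_cast
    rw [mul_assoc, mul_inv_cancel₀ (by positivity), mul_one]
    have : (m : ℝ) ≤ 2 ^ s := by exact_mod_cast hmp
    linarith
  have hsum : ∑' m : ℕ, (volume.restrict (Ico (0 : ℝ) 1))
      {x | ¬ m - 2 * (Nat.log 2 m + 1) ≤ runLen x (2 ^ m)} ≠ ⊤ := by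
    refine ne_top_of_le_ne_top ?_ (ENNReal.tsum_le_tsum key)
    apply Summable.tsum_ofReal_ne_top
    exact Real.summable_exp_neg_nat
  filter_upwards [ae_eventually_notMem hsum] with x hx
  simpa using hx

lemma erl_log_div : Tendsto (fun m : ℕ => (Nat.log 2 m : ℝ) / m) atTop (nhds 0) := by
  have h : Tendsto (fun m : ℕ => Real.log m / m * (Real.log 2)⁻¹) atTop (nhds 0) := by
    have := (Real.isLittleO_log_id_atTop.tendsto_div_nhds_zero.comp
      (tendsto_natCast_atTop_atTop (R := ℝ))).mul_const (Real.log 2)⁻¹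
    simpa using this
  refine squeeze_zero' (Eventually.of_forall fun m => by positivity) ?_ h
  filter_upwards [eventually_ge_atTop 1] with m hm
  have hm' : (0 : ℝ) < m := by exact_mod_cast hm
  have h1 : (Nat.log 2 m : ℝ) ≤ Real.logb 2 m := Real.natLog_le_logb m 2
  rw [Real.logb] at h1
  calc _ ≤ Real.log m / Real.log 2 / m := by gcongr
    _ = _ := by ring

theorem erdos_renyi_runLen :
    ∀ᵐ x ∂(volume.restrict (Set.Icc (0 : ℝ) 1)),
      Tendsto (fun n : ℕ => (runLen x n : ℝ) / Real.logb 2 n) atTop (nhds 1) := by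
  rw [← Measure.restrict_congr_set (Ico_ae_eq_Icc (μ := volume) (a := (0 : ℝ)) (b := 1))]
  filter_upwards [erl_ae_upper, erl_ae_lower] with x hu hl
  have hlog : Tendsto (fun n : ℕ => Nat.log 2 n) atTop atTop := by
    refine tendsto_atTop_atTop.2 fun b => ⟨2 ^ b, fun n hn => ?_⟩
    exact (Nat.le_log_iff_pow_le (by norm_num) (by have := Nat.one_le_two_pow (n := b); omega)).2 hn
  have hinv : Tendsto (fun m : ℕ => (1 : ℝ) / m) atTop (nhds 0) := tendsto_one_div_atTop_nhds_zero_nat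
  have hup : Tendsto (fun m : ℕ => 1 + 5 * ((1 : ℝ) / m) + 2 * ((Nat.log 2 m : ℝ) / m)) atTop
      (nhds 1) := by
    simpa using ((hinv.const_mul 5).const_add 1).add (erl_log_div.const_mul 2)
  have hlo : Tendsto (fun m : ℕ => 1 - 3 * ((1 : ℝ) / m) - 2 * ((Nat.log 2 m : ℝ) / m)) atTop
      (nhds 1) := by
    simpa using ((hinv.const_mul 3).const_sub 1).sub (erl_log_div.const_mul 2)
  have hu1 := hlog.eventually ((tendsto_add_atTop_nat 1).eventually hu)
  have hl1 := hlog.eventually hl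
  have hpos := hlog.eventually (eventually_ge_atTop 1)
  have hbd : ∀ᶠ n : ℕ in atTop, (Nat.log 2 n : ℝ) ≤ Real.logb 2 n ∧
      Real.logb 2 n ≤ Nat.log 2 n + 1 := by
    filter_upwards [eventually_ge_atTop 1] with n hn
    have hn' : (0 : ℝ) < n := by exact_mod_cast hn
    refine ⟨Real.natLog_le_logb n 2, ?_⟩
    rw [Real.logb_le_iff_le_rpow (by norm_num) hn']
    have := erl_le_pow n
    exact_mod_cast this
  refine tendsto_of_tendsto_of_tendsto_of_le_of_le' (hlo.comp hlog) (hup.comp hlog) ?_ ?_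
  · filter_upwards [hl1, hpos, hbd, eventually_ge_atTop 1] with n h1 h2 h3 hn
    simp only [Function.comp]
    set m := Nat.log 2 n with hm
    have hm' : (1 : ℝ) ≤ m := by exact_mod_cast h2
    have hr : m - 2 * (Nat.log 2 m + 1) ≤ runLen x n :=
      h1.trans (erl_mono x (Nat.pow_log_le_self 2 (by omega)))
    have hr' : (m : ℝ) - 2 * (Nat.log 2 m + 1) ≤ runLen x n := by
      have : m ≤ runLen x n + 2 * (Nat.log 2 m + 1) := by omega
      have : (m : ℝ) ≤ runLen x n + 2 * (Nat.log 2 m + 1) := by exact_mod_cast this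
      linarith
    have hL : (0 : ℝ) < Real.logb 2 n := by linarith [h3.1]
    rw [le_div_iff₀ hL]
    have e : 1 - 3 * ((1 : ℝ) / m) - 2 * ((Nat.log 2 m : ℝ) / m)
      = 1 - (3 + 2 * (Nat.log 2 m : ℝ)) / m := by ring
    have hq : (3 + 2 * (Nat.log 2 m : ℝ)) ≤ (3 + 2 * (Nat.log 2 m : ℝ)) / m * Real.logb 2 n := by
      calc _ = (3 + 2 * (Nat.log 2 m : ℝ)) / m * m := by field_simp
        _ ≤ _ := by gcongr; exact h3.1
    rw [e, sub_mul]
    linarith [h3.2]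
  · filter_upwards [hu1, hpos, hbd, eventually_ge_atTop 1] with n h1 h2 h3 hn
    simp only [Function.comp]
    set m := Nat.log 2 n with hm
    have hm' : (1 : ℝ) ≤ m := by exact_mod_cast h2
    have hs : Nat.log 2 (m + 1) ≤ Nat.log 2 m + 1 := by
      have e : Nat.log 2 (m * 2) = Nat.log 2 m + 1 :=
        Nat.log_mul_base (by norm_num) (by omega)
      rw [← e]
      exact Nat.log_mono_right (by omega)
    have hr : runLen x n ≤ m + 5 + 2 * Nat.log 2 m := by
      have := erl_mono x (Nat.lt_pow_succ_log_self (b := 2) (by norm_num) n).le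
      rw [Nat.succ_eq_add_one, ← hm] at this
      omega
    have hr' : (runLen x n : ℝ) ≤ m + 5 + 2 * Nat.log 2 m := by exact_mod_cast hr
    have hL : (0 : ℝ) < Real.logb 2 n := by linarith [h3.1]
    rw [div_le_iff₀ hL]
    calc _ ≤ (m : ℝ) + 5 + 2 * Nat.log 2 m := hr'
      _ = (1 + 5 * ((1 : ℝ) / m) + 2 * ((Nat.log 2 m : ℝ) / m)) * m := by field_simp
      _ ≤ _ := by gcongr; exact h3.1
end

section
/- The set E_max = {x ∈ [0,1] : liminf_{n→∞} r_n(x)/log₂ n = 0 and limsup_{n→∞} r_n(x)/log₂ n = +∞} has Hausdorff dimension 1 and is residual in [0,1]. -/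
open Filter MeasureTheory Set

/-- The exceptional set `E_max` of points of `[0,1]` where `r_n(x)/log₂ n` has
liminf `0` and limsup `+∞`. -/
noncomputable def EmaxLog : Set ℝ :=
  {x ∈ Set.Icc (0 : ℝ) 1 |
    atTop.liminf (fun n : ℕ => ((runLen x n / Real.logb 2 n : ℝ) : EReal)) = 0 ∧
    atTop.limsup (fun n : ℕ => ((runLen x n / Real.logb 2 n : ℝ) : EReal)) = ⊤}


lemma mem_Emax_of (x : ℝ) (hx : x ∈ Set.Icc (0:ℝ) 1)
    (h1 : ∀ N : ℕ, ∃ n ≥ N, (runLen x n : ℝ) * N ≤ Real.logb 2 n)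
    (h2 : ∀ N : ℕ, ∃ n ≥ N, (N : ℝ) * Real.logb 2 n ≤ runLen x n) : x ∈ EmaxLog := by
  have lpos : ∀ n : ℕ, 2 ≤ n → 0 < Real.logb 2 n := fun n hn =>
    Real.logb_pos (by norm_num) (by exact_mod_cast hn)
  refine ⟨hx, le_antisymm ?_ ?_, ?_⟩
  · refine le_of_forall_gt_imp_ge_of_dense fun e he => ?_
    obtain ⟨q, hq0, hqe⟩ := EReal.lt_iff_exists_real_btwn.1 he
    have hq0' : 0 < q := by exact_mod_cast hq0
    refine liminf_le_of_frequently_le' ?_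
    rw [frequently_atTop]
    intro a
    obtain ⟨K, hK⟩ := exists_nat_gt (1 / q)
    obtain ⟨n, hn, h⟩ := h1 (max (max a 2) K)
    refine ⟨n, by omega, ?_⟩
    refine le_trans ?_ hqe.le
    have hl := lpos n (by omega)
    have : (runLen x n / Real.logb 2 n : ℝ) ≤ q := by
      rw [div_le_iff₀ hl]
      have hK' : 1 / q ≤ ((max (max a 2) K : ℕ) : ℝ) :=
        hK.le.trans (by exact_mod_cast le_max_right _ _)
      have h3 : (runLen x n : ℝ) * (1 / q) ≤ Real.logb 2 n :=
        (mul_le_mul_of_nonneg_left hK' (Nat.cast_nonneg _)).trans h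
      calc (runLen x n : ℝ) = q * ((runLen x n : ℝ) * (1 / q)) := by field_simp
        _ ≤ _ := mul_le_mul_of_nonneg_left h3 hq0'.le
    exact_mod_cast this
  · refine le_liminf_of_le (by isBoundedDefault) ?_
    filter_upwards [eventually_ge_atTop 2] with n hn
    have : 0 ≤ (runLen x n / Real.logb 2 n : ℝ) := div_nonneg (Nat.cast_nonneg _) (lpos n hn).le
    exact_mod_cast this
  · rw [eq_top_iff]
    refine le_of_forall_lt fun e he => ?_
    obtain ⟨q, hqe, -⟩ := EReal.lt_iff_exists_real_btwn.1 he
    refine hqe.trans_le (le_limsup_of_frequently_le' ?_)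
    rw [frequently_atTop]
    intro a
    obtain ⟨K, hK⟩ := exists_nat_gt q
    obtain ⟨n, hn, h⟩ := h2 (max (max a 2) K)
    refine ⟨n, by omega, ?_⟩
    have hl := lpos n (by omega)
    have : q ≤ (runLen x n / Real.logb 2 n : ℝ) := by
      rw [le_div_iff₀ hl]
      have hK' : q ≤ ((max (max a 2) K : ℕ) : ℝ) :=
        hK.le.trans (by exact_mod_cast le_max_right _ _)
      exact (mul_le_mul_of_nonneg_right hK' hl.le).trans h
    exact_mod_cast this

lemma runLen_le (x : ℝ) (n b : ℕ)
    (h : ∀ ℓ i, i + ℓ ≤ n → (∀ j < ℓ, dyadicDigit x (i + j + 1) = 1) → ℓ ≤ b) :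
    runLen x n ≤ b := by
  apply csSup_le'
  rintro ℓ ⟨i, hi, hj⟩
  exact h ℓ i hi hj

lemma le_runLen (x : ℝ) (n ℓ i : ℕ) (hi : i + ℓ ≤ n)
    (h : ∀ j < ℓ, dyadicDigit x (i + j + 1) = 1) : ℓ ≤ runLen x n := by
  apply le_csSup
  · refine ⟨n, ?_⟩
    rintro ℓ ⟨i, hi, hj⟩
    omega
  · exact ⟨i, hi, h⟩

lemma floor_pow_div (x : ℝ) (m z : ℕ) (h : m ≤ z) :
    ⌊x * 2 ^ m⌋ = ⌊x * 2 ^ z⌋ / 2 ^ (z - m) := by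
  have : x * 2 ^ m = x * 2 ^ z / ((2 ^ (z - m) : ℕ) : ℝ) := by
    push_cast
    rw [eq_div_iff (by positivity), mul_assoc, ← pow_add]
    congr 2; omega
  rw [this, Int.floor_div_natCast]
  push_cast; rfl

/-- separation -/
lemma sep (x x' : ℝ) (hx : 0 ≤ x) (m z : ℕ) (hmz : m < z) (hz : dyadicDigit x z = 0)
    (h : ⌊x * 2 ^ m⌋ < ⌊x' * 2 ^ m⌋) : 1 / 2 ^ z ≤ x' - x := by
  set A := ⌊x * 2 ^ z⌋ with hA
  set N := ⌊x * 2 ^ m⌋ with hN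
  have hA0 : 0 ≤ A := Int.floor_nonneg.2 (by positivity)
  have hAN : A / 2 ^ (z - m) = N := (floor_pow_div x m z hmz.le).symm
  have hlt : A < (N + 1) * 2 ^ (z - m) := by
    rw [← hAN]; exact Int.lt_ediv_add_one_mul_self _ (by positivity)
  have heven : A % 2 = 0 := by
    unfold dyadicDigit at hz
    rw [← hA] at hz
    omega
  have hle : A + 2 ≤ (N + 1) * 2 ^ (z - m) := by
    obtain ⟨t, ht⟩ : ∃ t, z - m = t + 1 := ⟨z - m - 1, by omega⟩
    rw [ht, pow_succ, ← mul_assoc] at hlt ⊢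
    omega
  have h1 : x * 2 ^ z < A + 1 := Int.lt_floor_add_one _
  have h2 : ((N + 1 : ℤ) : ℝ) ≤ x' * 2 ^ m := (Int.cast_le.2 h).trans (Int.floor_le _)
  have h3 : ((A + 2 : ℤ) : ℝ) ≤ (((N + 1) * 2 ^ (z - m) : ℤ) : ℝ) := Int.cast_le.2 hle
  push_cast at h2 h3
  have h4 : ((N:ℝ) + 1) * 2 ^ (z - m) ≤ x' * 2 ^ z := by
    have := mul_le_mul_of_nonneg_right h2 (by positivity : (0:ℝ) ≤ 2 ^ (z - m))
    rw [mul_assoc x', ← pow_add] at this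
    rwa [show m + (z - m) = z by omega] at this
  rw [div_le_iff₀ (by positivity)]
  nlinarith

lemma digits_of (d : ℕ → Fin 2) (hd : ∀ n, ∃ m ≥ n, d m = 0) (k : ℕ) :
    dyadicDigit (Real.ofDigits d) (k + 1) = d k := by
  have key : ∀ d : ℕ → Fin 2, (∃ m, d m = 0) → Real.ofDigits d < 1 := by
    rintro d ⟨m, hm⟩
    rw [← Real.ofDigits_const_last_eq_one' (b := 2) (by norm_num)]
    refine Summable.tsum_lt_tsum (i := m) ?_ ?_ Real.summable_ofDigitsTerm Real.summable_ofDigitsTerm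
    · intro n
      unfold Real.ofDigitsTerm
      have := (d n).is_lt
      gcongr
      simp; omega
    · unfold Real.ofDigitsTerm
      gcongr
      simp [hm]
  have fl : ∀ n, ∃ S : ℕ, ⌊Real.ofDigits d * 2 ^ (n + 1)⌋ = (2 * S + (d n : ℕ) : ℕ) := by
    intro n
    have e := Real.ofDigits_eq_sum_add_ofDigits d (n + 1)
    refine ⟨∑ i ∈ Finset.range n, 2 ^ (n - 1 - i) * (d i : ℕ), ?_⟩
    have h1 : Real.ofDigits (fun i => d (i + (n + 1))) < 1 := by
      apply key
      obtain ⟨m, hm, h⟩ := hd (n + 1)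
      exact ⟨m - (n + 1), by rwa [Nat.sub_add_cancel hm]⟩
    have h0 := Real.ofDigits_nonneg (fun i => d (i + (n + 1)))
    have hs : (∑ i ∈ Finset.range (n + 1), Real.ofDigitsTerm d i) * 2 ^ (n + 1)
        = ((2 * (∑ i ∈ Finset.range n, 2 ^ (n - 1 - i) * (d i : ℕ)) + (d n : ℕ) : ℕ) : ℝ) := by
      rw [Finset.sum_range_succ, add_mul]
      push_cast
      congr 1
      · rw [Finset.sum_mul, Finset.mul_sum]
        refine Finset.sum_congr rfl fun i hi => ?_
        have hi' := Finset.mem_range.1 hi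
        unfold Real.ofDigitsTerm
        have : (2:ℝ) ^ (n + 1) = 2 ^ (i + 1) * 2 ^ (n - 1 - i) * 2 := by
          rw [← pow_add, ← pow_succ]; congr 1; omega
        rw [this]; push_cast
        field_simp
      · unfold Real.ofDigitsTerm
        push_cast
        field_simp
    rw [Int.floor_eq_iff]
    have : Real.ofDigits d * 2 ^ (n + 1) =
        (∑ i ∈ Finset.range (n + 1), Real.ofDigitsTerm d i) * 2 ^ (n + 1)
          + Real.ofDigits (fun i => d (i + (n + 1))) := by
      rw [e]; push_cast; field_simp
    rw [this, hs]
    constructor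
    · push_cast; linarith
    · push_cast; linarith
  obtain ⟨S, hS⟩ := fl k
  unfold dyadicDigit
  rw [hS]
  have := (d k).is_lt
  rw [Int.toNat_natCast]
  omega

def aSeq : ℕ → ℕ
  | 0 => 1
  | k + 1 => 4 ^ aSeq k

lemma aSeq_strictMono : StrictMono aSeq := by
  refine strictMono_nat_of_lt_succ fun k => ?_
  exact Nat.lt_pow_self (by norm_num)

def InB (m : ℕ) : Prop := m ≤ 2 ^ Nat.log 2 m + (Nat.log 2 m) ^ 2

def FreeP (p m : ℕ) : Prop := ¬ InB m ∧ ¬ p ∣ m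

open Classical in
noncomputable def dig (p : ℕ) (e : ℕ → Fin 2) (m : ℕ) : Fin 2 :=
  if InB m then (if m ≠ 2 ^ Nat.log 2 m ∧ ∃ k, Nat.log 2 m = aSeq k then 1 else 0)
  else if p ∣ m then 0 else e (Nat.count (FreeP p) m)

lemma inB_pow (a : ℕ) : InB (2 ^ a) := by
  unfold InB
  rw [Nat.log_pow (by norm_num)]
  omega

lemma dig_pow (p : ℕ) (e : ℕ → Fin 2) (a : ℕ) : dig p e (2 ^ a) = 0 := by
  unfold dig
  rw [if_pos (inB_pow a), if_neg]
  rw [Nat.log_pow (by norm_num)]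
  simp

lemma dig_one_of_dvd (p : ℕ) (e : ℕ → Fin 2) (m : ℕ) (hp : p ∣ m) (h : dig p e m ≠ 0) :
    InB m ∧ ∃ k, Nat.log 2 m = aSeq k := by
  unfold dig at h
  split_ifs at h with h1 h2
  · exact ⟨h1, h2.2⟩
  all_goals simp at h

lemma zero_after (p : ℕ) (hp : 0 < p) (e : ℕ → Fin 2) (m : ℕ) (hm : FreeP p m) :
    ∃ z, m < z ∧ z ≤ m + p ∧ dig p e z = 0 := by
  obtain ⟨z, hz1, hz2, hz3⟩ : ∃ z, m < z ∧ z ≤ m + p ∧ p ∣ z := by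
    refine ⟨p * (m / p + 1), Nat.lt_mul_div_succ m hp, ?_, dvd_mul_right _ _⟩
    have := Nat.mul_div_le m p
    rw [mul_add]; omega
  by_cases h : dig p e z = 0
  · exact ⟨z, hz1, hz2, h⟩
  obtain ⟨hB, -⟩ := dig_one_of_dvd p e z hz3 h
  have hle : 2 ^ Nat.log 2 z ≤ z := Nat.pow_log_le_self 2 (by omega)
  refine ⟨2 ^ Nat.log 2 z, ?_, by omega, dig_pow _ _ _⟩
  by_contra hcon
  push Not at hcon
  apply hm.1
  have : Nat.log 2 m = Nat.log 2 z := by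
    refine le_antisymm (Nat.log_mono_right hz1.le) ?_
    exact Nat.le_log_of_pow_le (by norm_num) hcon
  unfold InB at *
  rw [this]; omega

noncomputable def G (p : ℕ) (e : ℕ → Fin 2) : ℝ := Real.ofDigits (fun i => dig p e (i + 1))

lemma digit_G (p : ℕ) (e : ℕ → Fin 2) (m : ℕ) (hm : 0 < m) :
    dyadicDigit (G p e) m = dig p e m := by
  obtain ⟨k, rfl⟩ : ∃ k, m = k + 1 := ⟨m - 1, by omega⟩
  refine digits_of _ (fun n => ⟨2 ^ n - 1, ?_, ?_⟩) k
  · have : n < 2 ^ n := Nat.lt_two_pow_self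
    omega
  · have : 0 < 2 ^ n := by positivity
    simp only [Nat.sub_add_cancel this]
    exact dig_pow _ _ _

lemma sq_lt_two_pow (a : ℕ) (h : 5 ≤ a) : a ^ 2 < 2 ^ a := by
  induction a, h using Nat.le_induction with
  | base => norm_num
  | succ n hn ih => rw [pow_succ 2]; nlinarith

lemma G_mem (p : ℕ) (hp : 0 < p) (e : ℕ → Fin 2) : G p e ∈ EmaxLog := by
  apply mem_Emax_of
  · exact ⟨Real.ofDigits_nonneg _, Real.ofDigits_le_one _⟩
  · intro N
    obtain ⟨k, hk⟩ : ∃ k, 3 * N + 6 + p ≤ aSeq k := ⟨_, aSeq_strictMono.id_le _⟩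
    set a := aSeq k with ha
    have ha2 : a < 2 ^ a := Nat.lt_two_pow_self
    have hsq := sq_lt_two_pow a (by omega)
    have h4 : 4 ^ a = 2 ^ a * 2 ^ a := by rw [← mul_pow]; norm_num
    have ha4 : a < 4 ^ a := Nat.lt_pow_self (by norm_num)
    have hlt : 4 ^ a < 2 ^ (4 ^ a) := Nat.lt_two_pow_self
    refine ⟨2 ^ (4 ^ a) - 1, by omega, ?_⟩
    have hr : runLen (G p e) (2 ^ (4 ^ a) - 1) ≤ 2 ^ a + a ^ 2 + p := by
      apply runLen_le
      intro ℓ i hi hj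
      by_contra hcon
      push Not at hcon
      obtain ⟨z, hz1, hz2, hz3⟩ : ∃ z, i + ℓ - p < z ∧ z ≤ i + ℓ ∧ p ∣ z := by
        refine ⟨p * ((i + ℓ) / p), ?_, Nat.mul_div_le _ _, dvd_mul_right _ _⟩
        have := Nat.lt_mul_div_succ (i + ℓ) hp
        rw [mul_add] at this; omega
      have h1 := hj (z - i - 1) (by omega)
      rw [show i + (z - i - 1) + 1 = z by omega, digit_G _ _ _ (by omega)] at h1
      obtain ⟨hB, k', hk'⟩ := dig_one_of_dvd p e z hz3 (by intro h; rw [h] at h1; simp at h1)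
      have hlog : Nat.log 2 z < 4 ^ a := Nat.log_lt_of_lt_pow (by omega) (by omega)
      have : aSeq k' < aSeq (k + 1) := by rw [← hk']; exact hlog
      have hkk : k' ≤ k := by have := aSeq_strictMono.lt_iff_lt.1 this; omega
      have hle : Nat.log 2 z ≤ a := by rw [hk', ha]; exact aSeq_strictMono.monotone hkk
      have : z ≤ 2 ^ a + a ^ 2 := hB.trans (by gcongr; norm_num)
      omega
    have hlog : ((4 ^ a - 1 : ℕ) : ℝ) ≤ Real.logb 2 ((2 ^ (4 ^ a) - 1 : ℕ) : ℝ) := by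
      rw [Real.le_logb_iff_rpow_le (by norm_num) (by exact_mod_cast (by omega)), Real.rpow_natCast]
      have : 2 ^ (4 ^ a - 1) ≤ 2 ^ (4 ^ a) - 1 := by
        obtain ⟨t, ht⟩ : ∃ t, 4 ^ a = t + 1 := ⟨4 ^ a - 1, by omega⟩
        rw [ht, pow_succ]
        have : 0 < 2 ^ t := by positivity
        simp only [Nat.add_sub_cancel]
        omega
      exact_mod_cast this
    refine le_trans ?_ hlog
    have : runLen (G p e) (2 ^ (4 ^ a) - 1) * N ≤ 4 ^ a - 1 := by
      have : runLen (G p e) (2 ^ (4 ^ a) - 1) * N ≤ (3 * 2 ^ a) * N :=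
        Nat.mul_le_mul_right _ (by omega)
      have h5 : 2 ^ a * (3 * N + 1) ≤ 2 ^ a * 2 ^ a := Nat.mul_le_mul_left _ (by omega)
      have : 2 ^ a * (3 * N + 1) = (3 * 2 ^ a) * N + 2 ^ a := by ring
      omega
    exact_mod_cast this
  · intro N
    obtain ⟨k, hk⟩ : ∃ k, N + 6 ≤ aSeq k := ⟨_, aSeq_strictMono.id_le _⟩
    set a := aSeq k with ha
    have ha2 : a < 2 ^ a := Nat.lt_two_pow_self
    have hsq := sq_lt_two_pow a (by omega)
    refine ⟨2 ^ a + a ^ 2, by omega, ?_⟩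
    have hr : a ^ 2 ≤ runLen (G p e) (2 ^ a + a ^ 2) := by
      refine le_runLen _ _ _ (2 ^ a) le_rfl fun j hj => ?_
      rw [digit_G _ _ _ (by omega)]
      have hl : Nat.log 2 (2 ^ a + j + 1) = a := by
        rw [Nat.log_eq_iff (by right; omega)]
        rw [pow_succ]; omega
      unfold dig InB
      rw [hl, if_pos (by omega), if_pos ⟨by omega, k, ha⟩]
      rfl
    have hlog : Real.logb 2 ((2 ^ a + a ^ 2 : ℕ) : ℝ) ≤ (a + 1 : ℕ) := by
      rw [Real.logb_le_iff_le_rpow (by norm_num) (by exact_mod_cast (by omega)), Real.rpow_natCast]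
      have : 2 ^ a + a ^ 2 ≤ 2 ^ (a + 1) := by rw [pow_succ 2 a]; omega
      exact_mod_cast this
    calc (N : ℝ) * Real.logb 2 ((2 ^ a + a ^ 2 : ℕ) : ℝ) ≤ N * (a + 1 : ℕ) := by gcongr
      _ ≤ _ := by
        have : N * (a + 1) ≤ a ^ 2 := by nlinarith
        exact_mod_cast this.trans hr

open Classical in
lemma count_split (p m : ℕ) :
    m ≤ Nat.count (FreeP p) m + Nat.count InB m + Nat.count (p ∣ ·) m := by
  induction m with
  | zero => simp
  | succ n ih =>
    simp only [Nat.count_succ]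
    by_cases h1 : InB n
    · simp only [h1, if_true]; omega
    · by_cases h2 : p ∣ n
      · simp only [h2, if_true]; omega
      · have : FreeP p n := ⟨h1, h2⟩
        simp only [this, if_true]; omega

open Classical in
lemma count_dvd (p m : ℕ) (hp : 0 < p) : Nat.count (p ∣ ·) m ≤ m / p + 1 := by
  have := Nat.count_modEq_card m hp 0
  simp only [Nat.modEq_zero_iff_dvd] at this
  have h2 : Nat.count (p ∣ ·) m = m / p + if 0 % p < m % p then 1 else 0 := by
    rw [← this]
  rw [h2]; split_ifs <;> omega

open Classical in
lemma count_inB (m : ℕ) : Nat.count InB m ≤ (Nat.log 2 m + 2) ^ 3 := by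
  rw [Nat.count_eq_card_filter_range]
  set L := Nat.log 2 m
  have hsub : (Finset.range m).filter InB ⊆
      insert 0 ((Finset.range (L + 1)).biUnion fun a => Finset.Icc (2 ^ a) (2 ^ a + a ^ 2)) := by
    intro n hn
    simp only [Finset.mem_filter, Finset.mem_range] at hn
    by_cases h0 : n = 0
    · simp [h0]
    · refine Finset.mem_insert_of_mem (Finset.mem_biUnion.2 ⟨Nat.log 2 n, ?_, ?_⟩)
      · rw [Finset.mem_range, Nat.lt_succ_iff]
        exact Nat.log_mono_right hn.1.le
      · exact Finset.mem_Icc.2 ⟨Nat.pow_log_le_self 2 h0, hn.2⟩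
  refine (Finset.card_le_card hsub).trans ((Finset.card_insert_le _ _).trans ?_)
  have : ((Finset.range (L + 1)).biUnion fun a => Finset.Icc (2 ^ a) (2 ^ a + a ^ 2)).card
      ≤ (L + 1) * (L ^ 2 + 1) := by
    refine Finset.card_biUnion_le.trans ?_
    refine (Finset.sum_le_card_nsmul _ _ (L ^ 2 + 1) ?_).trans (by simp)
    intro a ha
    have : a ≤ L := by have := Finset.mem_range.1 ha; omega
    simp only [Nat.card_Icc]
    have : a ^ 2 ≤ L ^ 2 := by gcongr
    omega
  nlinarith

lemma cube_bound (ε : ℝ) (hε : 0 < ε) : ∃ C : ℝ, 0 ≤ C ∧ ∀ L : ℕ, ((L : ℝ) + 2) ^ 3 ≤ ε * 2 ^ L + C := by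
  have h := tendsto_pow_const_div_const_pow_of_one_lt 3 (show (1:ℝ) < 2 by norm_num)
  have h2 := h.eventually (gt_mem_nhds (show 0 < ε / 4 by positivity))
  obtain ⟨L0, hL0⟩ := eventually_atTop.1 h2
  refine ⟨((L0 : ℝ) + 2) ^ 3, by positivity, fun L => ?_⟩
  by_cases hL : L0 ≤ L
  · have := hL0 (L + 2) (by omega)
    rw [div_lt_iff₀ (by positivity)] at this
    push_cast at this
    rw [pow_add] at this
    have h3 : (0:ℝ) ≤ ((L0 : ℝ) + 2) ^ 3 := by positivity
    linarith
  · have : (L : ℝ) ≤ L0 := by exact_mod_cast (by omega)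
    have : ((L : ℝ) + 2) ^ 3 ≤ ((L0 : ℝ) + 2) ^ 3 := by gcongr
    have : 0 ≤ ε * 2 ^ L := by positivity
    linarith

open Classical in
lemma count_free_s12 (r : ℝ) (hr : r < 1) : ∃ p : ℕ, 0 < p ∧ ∃ C : ℝ, 0 ≤ C ∧
    ∀ m : ℕ, r * m - C ≤ Nat.count (FreeP p) m := by
  obtain ⟨p, hp⟩ := exists_nat_gt (2 / (1 - r))
  have h1r : 0 < 1 - r := by linarith
  have hp0 : (0:ℝ) < p := lt_trans (by positivity) hp
  obtain ⟨C, hC0, hC⟩ := cube_bound ((1 - r) / 2) (by linarith)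
  refine ⟨p, by exact_mod_cast hp0, C + 1, by linarith, fun m => ?_⟩
  rcases Nat.eq_zero_or_pos m with rfl | hm
  · simp; linarith
  have a1 := count_split p m
  have a2 := count_dvd p m (by exact_mod_cast hp0)
  have a3 := count_inB m
  have a4 := hC (Nat.log 2 m)
  have a5 : 2 ^ Nat.log 2 m ≤ m := Nat.pow_log_le_self 2 (by omega)
  have a6 : ((m / p : ℕ) : ℝ) ≤ (m : ℝ) / p := Nat.cast_div_le
  have a7 : (m : ℝ) / p ≤ (1 - r) / 2 * m := by
    rw [div_le_iff₀ hp0]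
    rw [div_lt_iff₀ h1r] at hp
    have : (0:ℝ) < m := by exact_mod_cast hm
    nlinarith
  have a1' : (m : ℝ) ≤ Nat.count (FreeP p) m + Nat.count InB m + Nat.count (p ∣ ·) m := by
    exact_mod_cast a1
  have a2' : (Nat.count (p ∣ ·) m : ℝ) ≤ (m / p : ℕ) + 1 := by exact_mod_cast a2
  have a3' : (Nat.count InB m : ℝ) ≤ ((Nat.log 2 m : ℝ) + 2) ^ 3 := by exact_mod_cast a3
  have a5' : (2:ℝ) ^ Nat.log 2 m ≤ m := by exact_mod_cast a5
  have a8 : (1 - r) / 2 * 2 ^ Nat.log 2 m ≤ (1 - r) / 2 * m := by gcongr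
  linarith

open Classical in
lemma G_holder (r : NNReal) (hr0 : 0 < r) (hr : r < 1) : ∃ p : ℕ, 0 < p ∧ ∃ C : NNReal,
    ∀ y ∈ Set.Ico (0:ℝ) 1, ∀ y' ∈ Set.Ico (0:ℝ) 1,
      |y - y'| ≤ C * |G p (Real.digits y 2) - G p (Real.digits y' 2)| ^ (r : ℝ) := by
  obtain ⟨p, hp, C, hC0, hC⟩ := count_free_s12 r (by exact_mod_cast hr)
  refine ⟨p, hp, ⟨2 ^ (C + r * p), by positivity⟩, fun y hy y' hy' => ?_⟩
  rcases eq_or_ne y y' with rfl | hne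
  · simp only [sub_self, abs_zero]
    exact mul_nonneg (NNReal.coe_nonneg _) (by positivity)
  set e := Real.digits y 2
  set e' := Real.digits y' 2
  have hey : Real.ofDigits e = y := Real.ofDigits_digits (by norm_num) hy
  have hey' : Real.ofDigits e' = y' := Real.ofDigits_digits (by norm_num) hy'
  have hex : ∃ j, e j ≠ e' j := by
    by_contra hcon
    push Not at hcon
    apply hne
    rw [← hey, ← hey', funext hcon]
  set j := Nat.find hex with hj
  have hj1 : e j ≠ e' j := Nat.find_spec hex
  have hj2 : ∀ i < j, e i = e' i := fun i hi => not_not.1 (Nat.find_min hex hi)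
  have hyy : |y - y'| ≤ ((2:ℝ) ^ j)⁻¹ := by
    have := Real.abs_ofDigits_sub_ofDigits_le hj2
    rw [hey, hey'] at this
    exact_mod_cast this
  have hinf : (Set.ofPred (FreeP p)).Infinite := by
    intro hfin
    obtain ⟨m, hm⟩ := exists_nat_gt ((hfin.toFinset.card + C) / r)
    have hr0' : (0:ℝ) < r := hr0
    rw [div_lt_iff₀ hr0'] at hm
    have h1 := hC m
    have h2 : Nat.count (FreeP p) m ≤ hfin.toFinset.card := by
      rw [Nat.count_eq_card_filter_range]
      apply Finset.card_le_card
      intro n hn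
      simpa using (Finset.mem_filter.1 hn).2
    have h2' : (Nat.count (FreeP p) m : ℝ) ≤ hfin.toFinset.card := by exact_mod_cast h2
    linarith
  set m := Nat.nth (FreeP p) j with hm
  have hmF : FreeP p m := Nat.nth_mem_of_infinite hinf j
  have hcm : Nat.count (FreeP p) m = j := Nat.count_nth_of_infinite hinf j
  have hm0 : 0 < m := by
    rcases Nat.eq_zero_or_pos m with h | h
    · exact absurd (h ▸ dvd_zero p) hmF.2
    · exact h
  have hdig : ∀ e : ℕ → Fin 2, dyadicDigit (G p e) m = e j := by
    intro e
    rw [digit_G _ _ _ hm0]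
    unfold dig
    rw [if_neg hmF.1, if_neg hmF.2, hcm]
  have hfl : ⌊G p e * 2 ^ m⌋ ≠ ⌊G p e' * 2 ^ m⌋ := by
    intro h
    apply hj1
    have : dyadicDigit (G p e) m = dyadicDigit (G p e') m := by
      unfold dyadicDigit; rw [h]
    rw [hdig, hdig] at this
    exact Fin.ext this
  have main : ∀ e e' : ℕ → Fin 2, ⌊G p e * 2 ^ m⌋ < ⌊G p e' * 2 ^ m⌋ →
      1 / (2:ℝ) ^ (m + p) ≤ |G p e - G p e'| := by
    intro e e' h
    obtain ⟨z, hz1, hz2, hz3⟩ := zero_after p hp e m hmF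
    have := sep (G p e) (G p e') (Real.ofDigits_nonneg _) m z hz1
      (by rw [digit_G _ _ _ (by omega), hz3]; rfl) h
    rw [abs_sub_comm]
    refine le_trans ?_ (this.trans (le_abs_self _))
    gcongr
    norm_num
  have hsep : 1 / (2:ℝ) ^ (m + p) ≤ |G p e - G p e'| := by
    rcases lt_or_gt_of_ne hfl with h | h
    · exact main _ _ h
    · rw [abs_sub_comm]; exact main _ _ h
  refine hyy.trans ?_
  have h1 := hC m
  rw [hcm] at h1
  have h2 : (1 / (2:ℝ) ^ (m + p)) ^ (r : ℝ) ≤ |G p e - G p e'| ^ (r : ℝ) := by gcongr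
  have h3 : (1 / (2:ℝ) ^ (m + p)) ^ (r : ℝ) = 2 ^ (-((m + p : ℕ) * (r : ℝ))) := by
    rw [one_div, ← Real.rpow_natCast, ← Real.rpow_neg (by norm_num), ← Real.rpow_mul (by norm_num)]
    congr 1; ring
  rw [h3] at h2
  refine le_trans ?_ (mul_le_mul_of_nonneg_left h2 (NNReal.coe_nonneg _))
  rw [← Real.rpow_natCast, ← Real.rpow_neg (by norm_num)]
  show _ ≤ (2:ℝ) ^ (C + r * p) * _
  rw [← Real.rpow_add (by norm_num)]
  apply Real.rpow_le_rpow_of_exponent_le (by norm_num)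
  push_cast
  linarith

lemma dim_ge (r : NNReal) (hr0 : 0 < r) (hr : r < 1) : (r : ENNReal) ≤ dimH EmaxLog := by
  obtain ⟨p, hp, C, hC⟩ := G_holder r hr0 hr
  set g : ℝ → ℝ := fun y => G p (Real.digits y 2)
  have hinj : Set.InjOn g (Set.Ico 0 1) := by
    intro y hy y' hy' h
    have := hC y hy y' hy'
    have h' : G p (Real.digits y 2) = G p (Real.digits y' 2) := h
    rw [h', sub_self, abs_zero, Real.zero_rpow (by exact_mod_cast hr0.ne'), mul_zero] at this
    exact sub_eq_zero.1 (abs_nonpos_iff.1 this)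
  have hinv := hinj.leftInvOn_invFunOn
  set f := Function.invFunOn g (Set.Ico 0 1)
  have hH : HolderOnWith C r f (g '' Set.Ico 0 1) := by
    rintro _ ⟨y, hy, rfl⟩ _ ⟨y', hy', rfl⟩
    rw [hinv hy, hinv hy']
    have := hC y hy y' hy'
    rw [edist_dist, edist_dist, ENNReal.ofReal_rpow_of_nonneg dist_nonneg (NNReal.coe_nonneg _),
      ← ENNReal.ofReal_coe_nnreal, ← ENNReal.ofReal_mul (NNReal.coe_nonneg _)]
    exact ENNReal.ofReal_le_ofReal this
  have h1 := hH.dimH_image_le hr0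
  rw [hinv.image_image] at h1
  have h2 : dimH (Set.Ico (0:ℝ) 1) = 1 := by
    rw [Real.dimH_of_nonempty_interior]
    · simp
    · rw [interior_Ico]; exact ⟨1/2, by norm_num⟩
  rw [h2] at h1
  have h3 : dimH (g '' Set.Ico 0 1) ≤ dimH EmaxLog := by
    apply dimH_mono
    rintro _ ⟨y, hy, rfl⟩
    exact G_mem p hp _
  refine le_trans ?_ h3
  have h0 : (r : ENNReal) ≠ 0 := by exact_mod_cast hr0.ne'
  rw [ENNReal.le_div_iff_mul_le (Or.inl h0) (Or.inl ENNReal.coe_ne_top), one_mul] at h1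
  exact h1

lemma dim_eq : dimH EmaxLog = 1 := by
  apply le_antisymm
  · rw [← Real.dimH_univ]; exact dimH_mono (subset_univ _)
  · refine le_of_forall_lt fun c hc => ?_
    obtain ⟨r, h1, h2⟩ := ENNReal.lt_iff_exists_nnreal_btwn.1 hc
    refine h1.trans_le (dim_ge r ?_ (by exact_mod_cast h2))
    have : (0 : ENNReal) < r := (zero_le).trans_lt h1
    exact_mod_cast this

lemma digit_cyl (x : ℝ) (q M i : ℕ) (hi : i ≤ M) (h1 : (q : ℝ) / 2 ^ M < x)
    (h2 : x < (q + 1) / 2 ^ M) : dyadicDigit x i = (q / 2 ^ (M - i)) % 2 := by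
  have hf : ⌊x * 2 ^ M⌋ = (q : ℤ) := by
    rw [div_lt_iff₀ (by positivity)] at h1
    rw [lt_div_iff₀ (by positivity)] at h2
    rw [Int.floor_eq_iff]
    push_cast
    exact ⟨h1.le, h2⟩
  unfold dyadicDigit
  rw [floor_pow_div x i M hi, hf]
  norm_cast

lemma dense_aux (P : ℝ → Prop)
    (h : ∀ k m : ℕ, ∃ q L : ℕ, k * 2 ^ L ≤ q ∧ q + 1 ≤ (k + 1) * 2 ^ L ∧
      ∀ x : ℝ, (q : ℝ) / 2 ^ (m + L) < x → x < (q + 1) / 2 ^ (m + L) → P x) :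
    {x : Set.Icc (0:ℝ) 1 | P x} ∈ residual (Set.Icc (0:ℝ) 1) := by
  refine mem_of_superset (residual_of_dense_open isOpen_interior ?_) interior_subset
  rw [Metric.dense_iff]
  rintro ⟨x, hx0, hx1⟩ ε hε
  obtain ⟨m, hm⟩ := exists_pow_lt_of_lt_one hε (show (1/2:ℝ) < 1 by norm_num)
  have h2m : (0:ℝ) < 2 ^ m := by positivity
  obtain ⟨k, hk, hkx, hkx'⟩ : ∃ k : ℕ, k + 1 ≤ 2 ^ m ∧ (k:ℝ) / 2 ^ m ≤ x ∧ x ≤ (k + 1) / 2 ^ m := by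
    rcases hx1.eq_or_lt with rfl | hlt
    · have : 0 < 2 ^ m := by positivity
      refine ⟨2 ^ m - 1, by omega, ?_, ?_⟩
      · rw [div_le_one h2m, Nat.cast_sub (by omega)]; simp
      · rw [le_div_iff₀ h2m, Nat.cast_sub (by omega)]; simp
    · refine ⟨⌊x * 2 ^ m⌋₊, ?_, ?_, ?_⟩
      · rw [Nat.add_one_le_iff, Nat.floor_lt (by positivity)]
        push_cast; nlinarith
      · rw [div_le_iff₀ h2m]; exact Nat.floor_le (by positivity)
      · rw [le_div_iff₀ h2m]; exact (Nat.lt_floor_add_one _).le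
  obtain ⟨q, L, hq1, hq2, hP⟩ := h k m
  have hL : (0:ℝ) < 2 ^ (m + L) := by positivity
  have e1 : (k:ℝ) / 2 ^ m ≤ q / 2 ^ (m + L) := by
    rw [pow_add, div_le_div_iff₀ (by positivity) (by positivity)]
    have : (k:ℝ) * 2 ^ L ≤ q := by exact_mod_cast hq1
    nlinarith
  have e2 : ((q:ℝ) + 1) / 2 ^ (m + L) ≤ (k + 1) / 2 ^ m := by
    rw [pow_add, div_le_div_iff₀ (by positivity) (by positivity)]
    have : (q:ℝ) + 1 ≤ (k + 1) * 2 ^ L := by exact_mod_cast hq2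
    nlinarith
  have e3 : ((k:ℝ) + 1) / 2 ^ m ≤ 1 := by
    rw [div_le_one h2m]; exact_mod_cast hk
  have e4 : (0:ℝ) ≤ k / 2 ^ m := by positivity
  have e5 : (q:ℝ) / 2 ^ (m + L) < (q + 1) / 2 ^ (m + L) := by gcongr; linarith
  obtain ⟨c, hc1, hc2⟩ := exists_between e5
  refine ⟨⟨c, by linarith, by linarith⟩, ?_, ?_⟩
  · rw [Metric.mem_ball, Subtype.dist_eq, Real.dist_eq]
    have e6 : ((k:ℝ) + 1) / 2 ^ m = k / 2 ^ m + (1/2) ^ m := by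
      rw [add_div, div_pow, one_pow]
    simp only
    rw [abs_lt]; constructor <;> linarith
  · rw [mem_interior]
    refine ⟨(fun x : Set.Icc (0:ℝ) 1 => (x:ℝ)) ⁻¹' Set.Ioo ((q:ℝ) / 2 ^ (m + L)) ((q + 1) / 2 ^ (m + L)),
      ?_, isOpen_Ioo.preimage continuous_subtype_val, ⟨hc1, hc2⟩⟩
    rintro y ⟨hy1, hy2⟩
    exact hP y hy1 hy2

lemma res_low (N : ℕ) : {x : Set.Icc (0:ℝ) 1 | ∃ n ≥ N, (runLen x n : ℝ) * N ≤ Real.logb 2 n}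
    ∈ residual (Set.Icc (0:ℝ) 1) := by
  apply dense_aux (fun x => ∃ n ≥ N, (runLen x n : ℝ) * N ≤ Real.logb 2 n)
  intro k m
  refine ⟨k * 2 ^ (N + 2 ^ (m * N)), N + 2 ^ (m * N), le_rfl, ?_, fun x hx1 hx2 => ?_⟩
  · have : 0 < 2 ^ (N + 2 ^ (m * N)) := by positivity
    rw [add_mul]; omega
  set L := N + 2 ^ (m * N)
  have hNL : N ≤ L := Nat.le_add_right _ _
  refine ⟨m + L, by omega, ?_⟩
  have hr : runLen x (m + L) ≤ m := by
    apply runLen_le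
    intro ℓ i hi hj
    by_contra hcon
    have h1 := hj (ℓ - 1) (by omega)
    rw [digit_cyl x _ _ _ (by omega) hx1 hx2] at h1
    obtain ⟨t, ht⟩ : ∃ t, L = (m + L - (i + (ℓ - 1) + 1)) + (t + 1) :=
      ⟨L - (m + L - (i + (ℓ - 1) + 1)) - 1, by omega⟩
    set s := m + L - (i + (ℓ - 1) + 1)
    rw [ht, pow_add, mul_comm (2 ^ s), ← mul_assoc, Nat.mul_div_cancel _ (by positivity), pow_succ,
      ← mul_assoc] at h1
    omega
  have hlog : ((m * N : ℕ) : ℝ) ≤ Real.logb 2 ((m + L : ℕ) : ℝ) := by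
    have : 0 < 2 ^ (m * N) := by positivity
    have : 2 ^ (m * N) ≤ m + L := by omega
    rw [Real.le_logb_iff_rpow_le (by norm_num) (by exact_mod_cast (by omega)), Real.rpow_natCast]
    exact_mod_cast this
  refine le_trans ?_ hlog
  exact_mod_cast Nat.mul_le_mul_right _ hr

lemma res_high (N : ℕ) : {x : Set.Icc (0:ℝ) 1 | ∃ n ≥ N, (N : ℝ) * Real.logb 2 n ≤ runLen x n}
    ∈ residual (Set.Icc (0:ℝ) 1) := by
  apply dense_aux (fun x => ∃ n ≥ N, (N : ℝ) * Real.logb 2 n ≤ runLen x n)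
  intro k m
  set a := N + m + 6 with ha
  have ha2 : a < 2 ^ a := Nat.lt_two_pow_self
  have hpos : 0 < 2 ^ (2 ^ a) := by positivity
  refine ⟨(k + 1) * 2 ^ (2 ^ a) - 1, 2 ^ a, ?_, ?_, fun x hx1 hx2 => ?_⟩
  · rw [add_mul]; omega
  · rw [add_mul]; omega
  refine ⟨m + 2 ^ a, by omega, ?_⟩
  have hr : 2 ^ a ≤ runLen x (m + 2 ^ a) := by
    refine le_runLen _ _ _ m le_rfl fun j hj => ?_
    rw [digit_cyl x _ _ _ (by omega) hx1 hx2]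
    obtain ⟨t, ht⟩ : ∃ t, 2 ^ a = (m + 2 ^ a - (m + j + 1)) + (t + 1) := ⟨j, by omega⟩
    set s := m + 2 ^ a - (m + j + 1)
    have hs : 0 < 2 ^ s := by positivity
    have : ((k + 1) * 2 ^ (2 ^ a) - 1) / 2 ^ s = (k + 1) * 2 ^ (t + 1) - 1 := by
      have hp : 0 < (k + 1) * 2 ^ (t + 1) := by positivity
      rw [ht, pow_add, mul_comm (2 ^ s), ← mul_assoc]
      obtain ⟨u, hu⟩ : ∃ u, (k + 1) * 2 ^ (t + 1) = u + 1 := ⟨_, (Nat.sub_add_cancel hp).symm⟩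
      rw [hu, Nat.add_sub_cancel, Nat.div_eq_iff hs, add_mul]
      omega
    rw [this, pow_succ, ← mul_assoc]
    have : 0 < (k + 1) * 2 ^ t := by positivity
    omega
  have hlog : Real.logb 2 ((m + 2 ^ a : ℕ) : ℝ) ≤ (a + 1 : ℕ) := by
    rw [Real.logb_le_iff_le_rpow (by norm_num) (by exact_mod_cast (by omega)), Real.rpow_natCast]
    have : m + 2 ^ a ≤ 2 ^ (a + 1) := by rw [pow_succ 2 a]; omega
    exact_mod_cast this
  calc (N : ℝ) * Real.logb 2 ((m + 2 ^ a : ℕ) : ℝ) ≤ N * (a + 1 : ℕ) := by gcongr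
    _ ≤ _ := by
      have := sq_lt_two_pow a (by omega)
      have : N * (a + 1) ≤ a ^ 2 := by nlinarith
      have : N * (a + 1) ≤ runLen x (m + 2 ^ a) := by omega
      exact_mod_cast this

theorem dimH_EmaxLog_eq_one_and_residual :
    dimH EmaxLog = 1 ∧
      ((↑) : Set.Icc (0 : ℝ) 1 → ℝ) ⁻¹' EmaxLog ∈ residual (Set.Icc (0 : ℝ) 1) := by
  refine ⟨dim_eq, ?_⟩
  filter_upwards [eventually_countable_forall.2 res_low, eventually_countable_forall.2 res_high]
    with x h1 h2
  exact mem_Emax_of x x.2 h1 h2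
end
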